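/- Let $k$ be an algebraically closed field, and let $V\subseteq \mathbb P^n_k$ and $W\subseteq \mathbb P^m_k$ be two normal complete intersection varieties of positive dimension (a variety $V$ in $\mathbb P^n$ is a complete intersection if its homogeneous ideal is generated by $\operatorname{codim}(V,\mathbb P^n)$ forms). Assume that either $\dim V+\dim W>2$, or $\dim V=\dim W=1$ and $n=m=2$. Let $V\times W\subseteq\mathbb P^n\times\mathbb P^m\subseteq\mathbb P^N$, $N=(n+1)(m+1)-1$, be the embedding induced by the Segre embedding. Then $V\times W\subseteq\mathbb P^N$ is projectively normal, i.e. its homogeneous coordinate ring is an integrally closed domain; equivalently, the restriction map $$H^0\bigl(\mathbb P^n\times\mathbb P^m,\ \mathcal O_{\mathbb P^N}(d)|_{\mathbb P^n\times\mathbb P^m}\bigr)\to H^0\bigl(V\times W,\ \mathcal O_{\mathbb P^N}(d)|_{V\times W}\bigr)$$ is surjective for every $d\in\mathbb N$. -/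

import Mathlib

open scoped LinearAlgebra.Projectivization
open TopologicalSpace (IrreducibleCloseds)

noncomputable section

namespace ProjVar

variable {k : Type*} [Field k] {σ τ : Type*}

/-- The (closed points of the) projective space over `k` with homogeneous coordinates indexed
by `σ`; projective `n`-space is `ProjSpace k (Fin (n + 1))`. -/
abbrev ProjSpace (k : Type*) [Field k] (σ : Type*) : Type _ := ℙ k (σ → k)

/-- The locus of points of projective space at which the form `F` does not vanish. (For `F`
homogeneous this does not depend on the representative of `p`.) -/
def basicOpen (F : MvPolynomial σ k) : Set (ProjSpace k σ) :=
  {p | MvPolynomial.eval p.rep F ≠ 0}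

/-- The Zariski topology on projective space: the non-vanishing loci of forms are a basis. -/
instance zariskiTopology : TopologicalSpace (ProjSpace k σ) :=
  TopologicalSpace.generateFrom
    {U | ∃ (F : MvPolynomial σ k) (d : ℕ), F.IsHomogeneous d ∧ U = basicOpen F}

/-- The affine cone `C(X) ⊆ 𝔸^σ` over `X`, including the vertex `0`. -/
def affineCone (X : Set (ProjSpace k σ)) : Set (σ → k) :=
  {v | ∀ hv : v ≠ 0, Projectivization.mk k v hv ∈ X}

/-- The affine cone over `X` without its vertex. -/
def puncturedCone (X : Set (ProjSpace k σ)) : Set (σ → k) :=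
  {v | ∃ hv : v ≠ 0, Projectivization.mk k v hv ∈ X}

theorem puncturedCone_mono {X Y : Set (ProjSpace k σ)} (h : X ⊆ Y) :
    puncturedCone X ⊆ puncturedCone Y := fun _ ⟨hv, hX⟩ => ⟨hv, h hX⟩

/-- The homogeneous ideal `I(X)` of a nonempty set `X` of points of projective space (`k` being
infinite): the polynomials vanishing on the affine cone over `X`. -/
def homogeneousIdeal (X : Set (ProjSpace k σ)) : Ideal (MvPolynomial σ k) :=
  MvPolynomial.vanishingIdeal k (affineCone X)

/-- The homogeneous coordinate ring `S(X) = k[x_i : i ∈ σ] / I(X)`. -/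
abbrev CoordRing (X : Set (ProjSpace k σ)) : Type _ :=
  MvPolynomial σ k ⧸ homogeneousIdeal X

/-- The image of a polynomial in the (total) fraction ring of `S(X)`. -/
def toFrac (X : Set (ProjSpace k σ)) : MvPolynomial σ k →+* FractionRing (CoordRing X) :=
  (algebraMap (CoordRing X) (FractionRing (CoordRing X))).comp
    (Ideal.Quotient.mk (homogeneousIdeal X))

/-- The local ring `𝒪_{X,p}` of a projective variety `X` at a point `p ∈ X`, as a subring of the
fraction field of `S(X)`: the fractions `z = F / G` of forms of the same degree with
`G(p) ≠ 0`. -/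
def localRing (X : Set (ProjSpace k σ)) (p : ProjSpace k σ) :
    Subring (FractionRing (CoordRing X)) where
  carrier := {z | ∃ (e : ℕ) (F G : MvPolynomial σ k), F.IsHomogeneous e ∧ G.IsHomogeneous e ∧
    p ∈ basicOpen G ∧ z * toFrac X G = toFrac X F}
  zero_mem' := ⟨0, 0, 1, MvPolynomial.isHomogeneous_zero _ _ _, MvPolynomial.isHomogeneous_one _ _,
    by simp [basicOpen], by simp⟩
  one_mem' := ⟨0, 1, 1, MvPolynomial.isHomogeneous_one _ _, MvPolynomial.isHomogeneous_one _ _,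
    by simp [basicOpen], by simp⟩
  neg_mem' := by
    rintro z ⟨e, F, G, hF, hG, hp, hz⟩
    exact ⟨e, -F, G, hF.neg, hG, hp, by rw [map_neg, ← hz, neg_mul]⟩
  add_mem' := by
    rintro z z' ⟨e, F, G, hF, hG, hp, hz⟩ ⟨e', F', G', hF', hG', hp', hz'⟩
    refine ⟨e + e', F * G' + G * F', G * G', (hF.mul hG').add (hG.mul hF'), hG.mul hG', ?_, ?_⟩
    · simp only [basicOpen, Set.mem_ofPred_eq, map_mul] at hp hp' ⊢
      exact mul_ne_zero hp hp'
    · simp only [map_add, map_mul, ← hz, ← hz']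
      ring
  mul_mem' := by
    rintro z z' ⟨e, F, G, hF, hG, hp, hz⟩ ⟨e', F', G', hF', hG', hp', hz'⟩
    refine ⟨e + e', F * F', G * G', hF.mul hF', hG.mul hG', ?_, ?_⟩
    · simp only [basicOpen, Set.mem_ofPred_eq, map_mul] at hp hp' ⊢
      exact mul_ne_zero hp hp'
    · simp only [map_mul, ← hz, ← hz']
      ring

/-- A projective variety is normal if all its local rings are integrally closed. -/
def IsNormal (V : IrreducibleCloseds (ProjSpace k σ)) : Prop :=
  ∀ p ∈ V, IsIntegrallyClosed (localRing (V : Set (ProjSpace k σ)) p)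

/-- The codimension of a variety in projective space: the supremum of the lengths of the chains
of irreducible closed subsets of projective space starting at `V`. -/
def codim (V : IrreducibleCloseds (ProjSpace k σ)) : ℕ∞ := Order.coheight V

/-- The dimension of a variety: the supremum of the lengths of the chains of its irreducible
closed subsets. -/
def dim (V : IrreducibleCloseds (ProjSpace k σ)) : WithBot ℕ∞ :=
  topologicalKrullDim (V : Set (ProjSpace k σ))

/-- A projective variety is a complete intersection if its homogeneous ideal is generated by
codimension-many forms. -/
def IsCompleteIntersection (V : IrreducibleCloseds (ProjSpace k σ)) : Prop :=
  ∃ (r : ℕ) (f : Fin r → MvPolynomial σ k), codim V = r ∧ (∀ i, ∃ e, (f i).IsHomogeneous e) ∧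
    homogeneousIdeal (V : Set (ProjSpace k σ)) = Ideal.span (Set.range f)

/-- `X` is projectively normal if its homogeneous coordinate ring is an integrally closed
domain. -/
def IsProjectivelyNormal (X : Set (ProjSpace k σ)) : Prop :=
  IsDomain (CoordRing X) ∧ IsIntegrallyClosed (CoordRing X)

/-- The space `H⁰(X, 𝒪(d)|_X)` of global sections of the restriction to the (reduced) projective
variety `X` of the twisting sheaf `𝒪(d)` of the ambient projective space. The fibre of `𝒪(d)` at
a point `p`, that is, at a line in `k^σ`, consists of the functions on the nonzero vectors of that
line that are homogeneous of degree `d`. So a section over `X` is a function on the punctured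
cone over `X` which, near every point of `X`, is a quotient `F / G` of forms with
`deg F = deg G + d`, where `G` has no zero. -/
def sections (X : Set (ProjSpace k σ)) (d : ℕ) : Submodule k (puncturedCone X → k) where
  carrier := {s | ∀ p ∈ X, ∃ (e : ℕ) (F G : MvPolynomial σ k),
    F.IsHomogeneous (e + d) ∧ G.IsHomogeneous e ∧ p ∈ basicOpen G ∧
    ∀ v : puncturedCone X, MvPolynomial.eval v.1 G ≠ 0 →
      s v = MvPolynomial.eval v.1 F / MvPolynomial.eval v.1 G}
  zero_mem' := fun p _ => ⟨0, 0, 1, MvPolynomial.isHomogeneous_zero _ _ _,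
    MvPolynomial.isHomogeneous_one _ _, by simp [basicOpen], by simp⟩
  add_mem' := by
    intro s s' hs hs' p hp
    obtain ⟨e, F, G, hF, hG, hpG, h⟩ := hs p hp
    obtain ⟨e', F', G', hF', hG', hpG', h'⟩ := hs' p hp
    refine ⟨e + e', F * G' + G * F', G * G', ?_, hG.mul hG', ?_, ?_⟩
    · refine MvPolynomial.IsHomogeneous.add ?_ ?_
      · convert hF.mul hG' using 1; ring
      · convert hG.mul hF' using 1; ring
    · simp only [basicOpen, Set.mem_ofPred_eq, map_mul] at hpG hpG' ⊢
      exact mul_ne_zero hpG hpG'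
    · intro v hv
      rw [map_mul] at hv
      have h1 := left_ne_zero_of_mul hv
      have h2 := right_ne_zero_of_mul hv
      simp only [Pi.add_apply, h v h1, h' v h2, map_add, map_mul]
      rw [div_add_div _ _ h1 h2]
  smul_mem' := by
    intro c s hs p hp
    obtain ⟨e, F, G, hF, hG, hpG, h⟩ := hs p hp
    refine ⟨e, MvPolynomial.C c * F, G, ?_, hG, hpG, ?_⟩
    · simpa using (MvPolynomial.isHomogeneous_C σ c).mul hF
    · intro v hv
      simp only [Pi.smul_apply, h v hv, smul_eq_mul, map_mul, MvPolynomial.eval_C, mul_div_assoc]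

/-- The restriction map `H⁰(Y, 𝒪(d)|_Y) → H⁰(X, 𝒪(d)|_X)` for `X ⊆ Y`. -/
def restrictSections {X Y : Set (ProjSpace k σ)} (h : X ⊆ Y) (d : ℕ) :
    sections Y d →ₗ[k] sections X d where
  toFun s := ⟨fun v => s.1 ⟨v.1, puncturedCone_mono h v.2⟩, fun p hp => by
    obtain ⟨e, F, G, hF, hG, hpG, hs⟩ := s.2 p (h hp)
    exact ⟨e, F, G, hF, hG, hpG, fun v hv => hs ⟨v.1, puncturedCone_mono h v.2⟩ hv⟩⟩
  map_add' _ _ := rfl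
  map_smul' _ _ := rfl

theorem mul_coords_ne_zero {v : σ → k} {w : τ → k} (hv : v ≠ 0) (hw : w ≠ 0) :
    (fun ij : σ × τ => v ij.1 * w ij.2) ≠ 0 := by
  obtain ⟨i, hi⟩ := Function.ne_iff.mp hv
  obtain ⟨j, hj⟩ := Function.ne_iff.mp hw
  exact Function.ne_iff.mpr ⟨(i, j), mul_ne_zero hi hj⟩

/-- The Segre embedding `([x_i], [y_j]) ↦ [x_i y_j]`, with homogeneous coordinates `z_{ij}` on the
target; for `σ = Fin (n + 1)` and `τ = Fin (m + 1)` the target is projective space of dimension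
`N = (n + 1) (m + 1) - 1`. -/
def segre (p : ProjSpace k σ × ProjSpace k τ) : ProjSpace k (σ × τ) :=
  Projectivization.mk k (fun ij => p.1.rep ij.1 * p.2.rep ij.2)
    (mul_coords_ne_zero p.1.rep_nonzero p.2.rep_nonzero)

/-- The Segre embedding does not depend on the representatives. -/
theorem segre_mk (v : σ → k) (w : τ → k) (hv : v ≠ 0) (hw : w ≠ 0) :
    segre (Projectivization.mk k v hv, Projectivization.mk k w hw) =
      Projectivization.mk k (fun ij : σ × τ => v ij.1 * w ij.2) (mul_coords_ne_zero hv hw) := by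
  obtain ⟨a, ha⟩ := Projectivization.exists_smul_eq_mk_rep k v hv
  obtain ⟨b, hb⟩ := Projectivization.exists_smul_eq_mk_rep k w hw
  rw [segre, Projectivization.mk_eq_mk_iff]
  refine ⟨a * b, ?_⟩
  funext ij
  simp only [← ha, ← hb, Pi.smul_apply, Units.smul_def, smul_eq_mul, Units.val_mul]
  ring

/-- `V × W`, embedded in projective space by the Segre embedding. -/
def segreProduct (V : Set (ProjSpace k σ)) (W : Set (ProjSpace k τ)) :
    Set (ProjSpace k (σ × τ)) :=
  segre '' (V ×ˢ W)

theorem segreProduct_subset (V : Set (ProjSpace k σ)) (W : Set (ProjSpace k τ)) :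
    segreProduct V W ⊆ segreProduct Set.univ Set.univ :=
  Set.image_mono (Set.prod_mono (Set.subset_univ V) (Set.subset_univ W))

end ProjVar

end

noncomputable section

namespace ProjVar

open Polynomial TensorProduct

section IntegralFraction

variable {R S : Type*} [CommRing R] [CommRing S]

/-- The fraction `a / b` is a root of a monic polynomial over `R`; this is expressed without
denominators. -/
def IsIntegralFraction (a b : R) : Prop :=
  ∃ p : R[X], p.Monic ∧ (p.scaleRoots b).eval a = 0

theorem IsIntegralFraction.map [Nontrivial S] (f : R →+* S) {a b : R}
    (h : IsIntegralFraction a b) : IsIntegralFraction (f a) (f b) := by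
  obtain ⟨p, hp, h0⟩ := h
  refine ⟨p.map f, hp.map f, ?_⟩
  rw [← map_scaleRoots _ _ _ (by simp [hp.leadingCoeff]), eval_map_apply, h0, map_zero]

theorem IsIntegralFraction.dvd [IsDomain R] [IsIntegrallyClosed R] {a b : R} (hb : b ≠ 0)
    (h : IsIntegralFraction a b) : b ∣ a := by
  obtain ⟨p, hp, h0⟩ := h
  let K := FractionRing R
  have hb' : algebraMap R K b ≠ 0 := by simpa using hb
  have hroot : eval₂ (algebraMap R K) (algebraMap R K a / algebraMap R K b) p = 0 := by
    have h1 := scaleRoots_eval₂_mul (p := p) (algebraMap R K)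
      (algebraMap R K a / algebraMap R K b) b
    rw [mul_div_cancel₀ _ hb', eval₂_at_apply, h0, map_zero] at h1
    exact (mul_eq_zero.mp h1.symm).resolve_left (pow_ne_zero _ hb')
  obtain ⟨y, hy⟩ := (isIntegrallyClosed_iff K).mp inferInstance ⟨p, hp, hroot⟩
  refine ⟨y, IsFractionRing.injective R K ?_⟩
  rw [map_mul, hy, mul_div_cancel₀ _ hb']

theorem isIntegrallyClosed_of_dvd [IsDomain R]
    (H : ∀ a b : R, b ≠ 0 → IsIntegralFraction a b → b ∣ a) : IsIntegrallyClosed R := by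
  rw [isIntegrallyClosed_iff (FractionRing R)]
  rintro x ⟨p, hp, hx⟩
  obtain ⟨a, b, hb, rfl⟩ := IsFractionRing.div_surjective (A := R) x
  have hb0 : b ≠ 0 := nonZeroDivisors.ne_zero hb
  have h := scaleRoots_eval₂_eq_zero_of_eval₂_div_eq_zero
    (IsFractionRing.injective R (FractionRing R)) hx hb
  rw [eval₂_at_apply] at h
  obtain ⟨c, rfl⟩ := H a b hb0
    ⟨p, hp, IsFractionRing.injective R (FractionRing R) (by rw [h, map_zero])⟩
  refine ⟨c, ?_⟩
  rw [map_mul, mul_div_cancel_left₀]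
  simpa using hb0

end IntegralFraction

/-- If `ψ` specializes into the span of the specializations of the `φ j` at all points where `h`
does not vanish, then a nonzero multiple of `ψ` is a linear combination of the `φ j`. -/
theorem exists_mul_eq_sum_of_generic {A k ι Ω : Type*} [CommRing A] [IsDomain A] [Field k]
    (ev : ι → A →+* k) (s : ℕ) (φ : Fin s → Ω → A) (ψ : Ω → A)
    (hev : ∀ a, (∀ i, ev i a = 0) → a = 0) (h : A) (h0 : h ≠ 0)
    (H : ∀ i, ev i h ≠ 0 → ∃ c : Fin s → k, ∀ ω, ev i (ψ ω) = ∑ j, c j * ev i (φ j ω)) :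
    ∃ g : A, g ≠ 0 ∧ ∃ c : Fin s → A, ∀ ω, g * ψ ω = ∑ j, c j * φ j ω := by
  induction s generalizing ψ h with
  | zero =>
    refine ⟨h, h0, Fin.elim0, fun ω => hev _ fun i => ?_⟩
    by_cases hi : ev i h = 0
    · simp [hi]
    · obtain ⟨c, hc⟩ := H i hi
      simp [hc]
  | succ s ih =>
    by_cases hφ : ∀ ω, φ 0 ω = 0
    · obtain ⟨g, hg, c, hc⟩ := ih (fun j => φ j.succ) ψ h h0 (fun i hi => by
        obtain ⟨c, hc⟩ := H i hi
        exact ⟨fun j => c j.succ, fun ω => by rw [hc, Fin.sum_univ_succ]; simp [hφ]⟩)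
      refine ⟨g, hg, Fin.cons 0 c, fun ω => ?_⟩
      simp [hc, Fin.sum_univ_succ]
    · push Not at hφ
      obtain ⟨ω₀, hω₀⟩ := hφ
      obtain ⟨g, hg, c, hc⟩ := ih
        (fun j ω => φ 0 ω₀ * φ j.succ ω - φ j.succ ω₀ * φ 0 ω)
        (fun ω => φ 0 ω₀ * ψ ω - ψ ω₀ * φ 0 ω) (h * φ 0 ω₀) (mul_ne_zero h0 hω₀)
        (fun i hi => by
          rw [map_mul] at hi
          obtain ⟨c, hc⟩ := H i (left_ne_zero_of_mul hi)
          refine ⟨fun j => c j.succ, fun ω => ?_⟩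
          simp only [map_sub, map_mul, hc, Fin.sum_univ_succ, mul_sub, Finset.sum_sub_distrib,
            add_mul, mul_add, Finset.mul_sum, Finset.sum_mul]
          have e1 : ∀ x : Fin s, ev i (φ 0 ω₀) * (c x.succ * ev i (φ x.succ ω)) =
            c x.succ * (ev i (φ 0 ω₀) * ev i (φ x.succ ω)) := fun x => by ring
          have e2 : ∀ x : Fin s, c x.succ * ev i (φ x.succ ω₀) * ev i (φ 0 ω) =
            c x.succ * (ev i (φ x.succ ω₀) * ev i (φ 0 ω)) := fun x => by ring
          simp only [e1, e2]
          ring)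
      refine ⟨g * φ 0 ω₀, mul_ne_zero hg hω₀,
        Fin.cons (g * ψ ω₀ - ∑ j, c j * φ j.succ ω₀) (fun j => c j * φ 0 ω₀), fun ω => ?_⟩
      have h1 := hc ω
      simp only [mul_sub, Finset.sum_sub_distrib] at h1
      simp only [Fin.sum_univ_succ, Fin.cons_zero, Fin.cons_succ, sub_mul, Finset.sum_mul]
      simp only [← mul_assoc] at h1 ⊢
      linear_combination h1

section TensorProduct

variable {k A B : Type*} [Field k] [CommRing A] [CommRing B] [Algebra k A] [Algebra k B]

/-- Every finite dimensional subspace has only finite dimensionally many divisors. -/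
def HasBoundedDivisors (k B : Type*) [Field k] [CommRing B] [Algebra k B] : Prop :=
  ∀ U : Submodule k B, U.FG →
    ∃ U' : Submodule k B, U'.FG ∧ ∀ g c : B, g ≠ 0 → g * c ∈ U → c ∈ U'

/-- The elements of `A` are separated by `k`-rational points. -/
def HasEnoughPoints (k A : Type*) [Field k] [CommRing A] [Algebra k A] : Prop :=
  ∀ a : A, (∀ v : A →ₐ[k] k, v a = 0) → a = 0

/-- Specialization of the first factor of a tensor product at a `k`-rational point. -/
def evalLeft (B : Type*) [CommRing B] [Algebra k B] (v : A →ₐ[k] k) : A ⊗[k] B →ₐ[k] B :=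
  Algebra.TensorProduct.lift ((Algebra.ofId k B).comp v) (AlgHom.id k B)
    fun _ _ => Commute.all _ _

/-- Specialization of the second factor of a tensor product at a `k`-rational point. -/
def evalRight (A : Type*) [CommRing A] [Algebra k A] (w : B →ₐ[k] k) : A ⊗[k] B →ₐ[k] A :=
  Algebra.TensorProduct.lift (AlgHom.id k A) ((Algebra.ofId k A).comp w)
    fun _ _ => Commute.all _ _

@[simp]
theorem evalLeft_tmul (v : A →ₐ[k] k) (a : A) (b : B) : evalLeft B v (a ⊗ₜ b) = v a • b := by
  simp [evalLeft, Algebra.ofId_apply, Algebra.smul_def]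

@[simp]
theorem evalRight_tmul (w : B →ₐ[k] k) (a : A) (b : B) : evalRight A w (a ⊗ₜ b) = w b • a := by
  simp [evalRight, Algebra.ofId_apply, Algebra.smul_def, mul_comm]

theorem apply_evalRight (v : A →ₐ[k] k) (w : B →ₐ[k] k) (u : A ⊗[k] B) :
    v (evalRight A w u) = w (evalLeft B v u) := by
  induction u with
  | zero => simp
  | tmul a b => simp [mul_comm]
  | add x y hx hy => simp [hx, hy]

theorem evalLeft_comm (w : B →ₐ[k] k) (u : A ⊗[k] B) :
    evalLeft A w (Algebra.TensorProduct.comm k A B u) = evalRight A w u := by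
  induction u with
  | zero => simp
  | tmul a b => simp
  | add x y hx hy => simp [hx, hy]

theorem eq_zero_of_evalLeft_eq_zero (hA : HasEnoughPoints k A) (u : A ⊗[k] B)
    (hu : ∀ v : A →ₐ[k] k, evalLeft B v u = 0) : u = 0 := by
  let e := Module.Basis.ofVectorSpace k B
  let e' := e.baseChange A
  have key : ∀ (v : A →ₐ[k] k) (u : A ⊗[k] B) (i), e.repr (evalLeft B v u) i = v (e'.repr u i) := by
    intro v u i
    induction u with
    | zero => simp
    | tmul a b => simp [e', mul_comm]
    | add x y hx hy => simp [hx, hy]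
  refine e'.repr.injective (Finsupp.ext fun i => ?_)
  rw [map_zero, Finsupp.zero_apply]
  exact hA _ fun v => by rw [← key, hu, map_zero, Finsupp.zero_apply]

theorem eq_zero_of_evalRight_eq_zero (hB : HasEnoughPoints k B) (u : A ⊗[k] B)
    (hu : ∀ w : B →ₐ[k] k, evalRight A w u = 0) : u = 0 :=
  (Algebra.TensorProduct.comm k A B).injective <| by
    rw [map_zero]
    exact eq_zero_of_evalLeft_eq_zero hB _ fun w => by rw [evalLeft_comm, hu]

theorem exists_fg_evalLeft_mem (u : A ⊗[k] B) :
    ∃ U : Submodule k B, U.FG ∧ ∀ v : A →ₐ[k] k, evalLeft B v u ∈ U := by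
  induction u with
  | zero => exact ⟨⊥, Submodule.fg_bot, by simp⟩
  | tmul a b =>
    exact ⟨k ∙ b, Submodule.fg_span_singleton b, fun v => by
      rw [evalLeft_tmul]; exact Submodule.smul_mem _ _ (Submodule.mem_span_singleton_self b)⟩
  | add x y hx hy =>
    obtain ⟨U, hU, h⟩ := hx
    obtain ⟨U', hU', h'⟩ := hy
    exact ⟨U ⊔ U', hU.sup hU', fun v => by
      rw [map_add]; exact Submodule.add_mem_sup (h v) (h' v)⟩

theorem isDomain_tensorProduct [IsDomain A] [IsDomain B] (hA : HasEnoughPoints k A)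
    (hB : HasEnoughPoints k B) : IsDomain (A ⊗[k] B) := by
  have hnt : Nontrivial (A ⊗[k] B) := by
    obtain ⟨v, -⟩ : ∃ v : A →ₐ[k] k, v 1 ≠ 0 := by
      by_contra! h
      exact one_ne_zero (hA 1 h)
    exact (evalLeft B v).toRingHom.domain_nontrivial
  have : NoZeroDivisors (A ⊗[k] B) := by
    refine ⟨fun {f g} hfg => ?_⟩
    by_contra! hne
    obtain ⟨w, hw⟩ : ∃ w, evalRight A w f ≠ 0 := by
      by_contra! h; exact hne.1 (eq_zero_of_evalRight_eq_zero hB _ h)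
    obtain ⟨w', hw'⟩ : ∃ w, evalRight A w g ≠ 0 := by
      by_contra! h; exact hne.2 (eq_zero_of_evalRight_eq_zero hB _ h)
    obtain ⟨v, hv⟩ : ∃ v : A →ₐ[k] k, v (evalRight A w f * evalRight A w' g) ≠ 0 := by
      by_contra! h; exact mul_ne_zero hw hw' (hA _ h)
    rw [map_mul, apply_evalRight, apply_evalRight] at hv
    have h1 : evalLeft B v f ≠ 0 := fun h => by simp [h] at hv
    have h2 : evalLeft B v g ≠ 0 := fun h => by simp [h] at hv
    exact mul_ne_zero h1 h2 (by rw [← map_mul, hfg, map_zero])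
  exact NoZeroDivisors.to_isDomain _

theorem exists_tmul_one_mul_eq [IsDomain A] [IsDomain B] [IsIntegrallyClosed B]
    (hA : HasEnoughPoints k A) (hB : HasEnoughPoints k B) (hbd : HasBoundedDivisors k B)
    {a b : A ⊗[k] B} (hb : b ≠ 0) (hab : IsIntegralFraction a b) :
    ∃ g : A, g ≠ 0 ∧ ∃ c : A ⊗[k] B, g ⊗ₜ[k] (1 : B) * a = b * c := by
  obtain ⟨U, hU, haU⟩ := exists_fg_evalLeft_mem a
  obtain ⟨U', hU', hdiv⟩ := hbd U hU
  obtain ⟨s, e, he⟩ := Submodule.fg_iff_exists_fin_generating_family.mp hU'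
  obtain ⟨w₀, hw₀⟩ : ∃ w, evalRight A w b ≠ 0 := by
    by_contra! h; exact hb (eq_zero_of_evalRight_eq_zero hB _ h)
  obtain ⟨g, hg, c, hc⟩ := exists_mul_eq_sum_of_generic (fun v : A →ₐ[k] k => (v : A →+* k)) s
    (fun j (w : B →ₐ[k] k) => evalRight A w (b * (1 ⊗ₜ e j))) (fun w => evalRight A w a) hA
    (evalRight A w₀ b) hw₀ (fun v hv => by
      have hv' : evalLeft B v b ≠ 0 := fun h => by
        apply hv
        simp [apply_evalRight, h]
      obtain ⟨c, hc⟩ := (hab.map (evalLeft B v : A ⊗[k] B →+* B)).dvd hv'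
      have hcU : c ∈ U' := hdiv _ _ hv' (by simpa [← hc] using haU v)
      rw [← he] at hcU
      obtain ⟨γ, rfl⟩ := (Submodule.mem_span_range_iff_exists_fun k).mp hcU
      refine ⟨γ, fun w => ?_⟩
      have := congrArg w hc
      simp only [RingHom.coe_coe, map_mul, map_sum, map_smul, smul_eq_mul, Finset.mul_sum] at this
      simp only [RingHom.coe_coe, apply_evalRight, this]
      refine Finset.sum_congr rfl fun j _ => ?_
      simp only [map_mul, evalLeft_tmul, map_one, one_smul]
      ring)
  refine ⟨g, hg, ∑ j, c j ⊗ₜ e j, ?_⟩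
  rw [← sub_eq_zero]
  refine eq_zero_of_evalRight_eq_zero hB _ fun w => ?_
  have h := hc w
  simp only [map_sub, map_mul, map_sum, evalRight_tmul, map_one, one_smul, h, Finset.mul_sum,
    sub_eq_zero]
  refine Finset.sum_congr rfl fun j _ => ?_
  simp only [Algebra.smul_def]
  ring

/-- The tensor product of integrally closed domains over `k` with enough `k`-rational points is
integrally closed. -/
theorem isIntegrallyClosed_tensorProduct [IsDomain A] [IsDomain B] [IsIntegrallyClosed A]
    [IsIntegrallyClosed B] (hA : HasEnoughPoints k A) (hB : HasEnoughPoints k B)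
    (hbA : HasBoundedDivisors k A) (hbB : HasBoundedDivisors k B) :
    IsIntegrallyClosed (A ⊗[k] B) := by
  have := isDomain_tensorProduct hA hB
  have := isDomain_tensorProduct hB hA
  refine isIntegrallyClosed_of_dvd fun a b hb hab => ?_
  obtain ⟨g, hg, c₁, h₁⟩ := exists_tmul_one_mul_eq hA hB hbB hb hab
  let τ := Algebra.TensorProduct.comm k A B
  obtain ⟨h, hh, c₂', h₂'⟩ := exists_tmul_one_mul_eq hB hA hbA
    (a := τ a) (b := τ b) (by simpa using hb) (hab.map (τ : A ⊗[k] B →+* B ⊗[k] A))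
  obtain ⟨c₂, rfl⟩ := τ.surjective c₂'
  have h₂ : (1 : A) ⊗ₜ[k] h * a = b * c₂ := τ.injective (by
    simpa [τ] using h₂')
  have h₁₂ : (1 : A) ⊗ₜ[k] h * c₁ = g ⊗ₜ[k] (1 : B) * c₂ := mul_left_cancel₀ hb (by
    rw [mul_left_comm, ← h₁, mul_left_comm b, ← h₂, mul_left_comm])
  obtain ⟨c, rfl⟩ : ∃ c, c₁ = g ⊗ₜ[k] (1 : B) * c := by
    let μ : A →ₗ[k] A := LinearMap.mulLeft k g
    let π : A →ₗ[k] A ⧸ LinearMap.range μ := (LinearMap.range μ).mkQ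
    have hex : Function.Exact (μ.rTensor B) (π.rTensor B) :=
      rTensor_exact B (LinearMap.exact_map_mkQ_range μ) (Submodule.mkQ_surjective _)
    have hμ : ∀ u, μ.rTensor B u = g ⊗ₜ[k] (1 : B) * u := by
      intro u
      induction u with
      | zero => simp
      | tmul a b => simp [μ]
      | add x y hx hy => rw [map_add, hx, hy, mul_add]
    let ν : B →ₗ[k] B := LinearMap.mulLeft k h
    have hν : ∀ u, ν.lTensor A u = (1 : A) ⊗ₜ[k] h * u := by
      intro u
      induction u with
      | zero => simp
      | tmul a b => simp [ν]
      | add x y hx hy => rw [map_add, hx, hy, mul_add]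
    have hinj : Function.Injective (ν.lTensor (A ⧸ LinearMap.range μ)) :=
      Module.Flat.lTensor_preserves_injective_linearMap ν (mul_right_injective₀ hh)
    have hz : π.rTensor B c₁ = 0 := hinj (by
      rw [map_zero, ← LinearMap.comp_apply, LinearMap.lTensor_comp_rTensor,
        ← LinearMap.rTensor_comp_lTensor, LinearMap.comp_apply, hν, h₁₂, ← hμ]
      exact hex.apply_apply_eq_zero c₂)
    obtain ⟨c, hc⟩ := (hex c₁).mp hz
    exact ⟨c, by rw [← hμ, hc]⟩
  refine ⟨c, mul_left_cancel₀ (a := g ⊗ₜ[k] (1 : B)) (fun h0 => hg ?_) ?_⟩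
  · refine hA g fun v => ?_
    simpa [Algebra.smul_def] using congrArg (evalLeft B v) h0
  · rw [h₁]; ring

end TensorProduct

end ProjVar

end

noncomputable section

namespace ProjVar

section Depth

open IsLocalRing RingTheory.Sequence Module Pointwise CategoryTheory Abelian Limits

universe u

variable {R : Type u} [CommRing R] [IsLocalRing R]
  {M : Type u} [AddCommGroup M] [Module R M]

variable (R M) in
/-- The depth of the module `M` over the local ring `R` is at least `h`. -/
def DepthGE (h : ℕ) : Prop :=
  ∃ rs : List R, rs.length = h ∧ (∀ r ∈ rs, r ∈ maximalIdeal R) ∧ IsRegular M rs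

theorem DepthGE.congr {M' : Type u} [AddCommGroup M'] [Module R M'] (e : M ≃ₗ[R] M') {h : ℕ}
    (H : DepthGE R M h) : DepthGE R M' h := by
  obtain ⟨rs, h1, h2, h3⟩ := H
  exact ⟨rs, h1, h2, (e.isRegular_congr rs).mp h3⟩

theorem maximalIdeal_smul_top_lt [Nontrivial M] [Module.Finite R M] :
    maximalIdeal R • (⊤ : Submodule R M) < ⊤ :=
  (Submodule.top_ne_ideal_smul_of_le_jacobson_annihilator
    (maximalIdeal_le_jacobson _)).symm.lt_top

theorem DepthGE.eq_zero_of_maximalIdeal_smul_eq_zero {h : ℕ} (H : DepthGE R M (h + 1)) (x : M)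
    (hx : ∀ r ∈ maximalIdeal R, r • x = 0) : x = 0 := by
  obtain ⟨_ | ⟨a, rs⟩, h1, hmem, hreg⟩ := H
  · simp at h1
  · rw [isRegular_cons_iff] at hreg
    exact hreg.1.right_eq_zero_of_smul (hx a (hmem a (by simp)))

variable [IsNoetherianRing R] [Module.Finite R M]

theorem DepthGE.quotSMulTop {h : ℕ} (H : DepthGE R M (h + 1)) {x : R} (hx : x ∈ maximalIdeal R)
    (hreg : IsSMulRegular M x) : DepthGE R (QuotSMulTop x M) h := by
  have hM : Nontrivial M := by
    obtain ⟨rs, -, -, h3⟩ := H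
    exact h3.nontrivial
  have : Nontrivial (QuotSMulTop x M) := nontrivial_quotSMulTop_of_mem_maximalIdeal M hx
  have t1 := (ModuleCat.exists_isRegular_tfae (maximalIdeal R) (h + 1) (ModuleCat.of R M)
    maximalIdeal_smul_top_lt).out 1 3
  have t2 := (ModuleCat.exists_isRegular_tfae (maximalIdeal R) h
    (ModuleCat.of R (QuotSMulTop x M)) maximalIdeal_smul_top_lt).out 1 3
  refine t2.mp fun i hi => ?_
  have h_ext := t1.mpr H
  have hreg' : IsSMulRegular (ModuleCat.of R M) x := hreg
  have zero1 := AddCommGrpCat.isZero_of_iff_subsingleton.mpr (h_ext i (by omega))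
  have zero2 := AddCommGrpCat.isZero_of_iff_subsingleton.mpr (h_ext (i + 1) (by omega))
  exact AddCommGrpCat.subsingleton_of_isZero <| ShortComplex.Exact.isZero_of_both_zeros
    ((Ext.covariant_sequence_exact₃' _ hreg'.smulShortComplex_shortExact) i (i + 1) rfl)
    (zero1.eq_zero_of_src _) (zero2.eq_zero_of_tgt _)

theorem ringKrullDim_quotient_succ_le_of_lt {q q' : Ideal R} [q.IsPrime]
    [q'.IsPrime] (hlt : q < q') :
    ringKrullDim (R ⧸ q') + 1 ≤ ringKrullDim (R ⧸ q) := by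
  obtain ⟨a, haq', haq⟩ := SetLike.exists_of_lt hlt
  have hreg : IsSMulRegular (R ⧸ q) a := by
    rw [isSMulRegular_quotient_iff_mem_of_smul_mem]
    intro x hx
    exact (Ideal.IsPrime.mem_or_mem ‹q.IsPrime› hx).resolve_left haq
  rw [← supportDim_quotient_eq_ringKrullDim, ← supportDim_quotient_eq_ringKrullDim,
    ← supportDim_quotSMulTop_succ_eq_supportDim hreg (le_maximalIdeal (Ideal.IsPrime.ne_top ‹_›)
      haq')]
  gcongr
  let f : (R ⧸ q) →ₗ[R] R ⧸ q' := Submodule.factor hlt.le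
  have hf : (a • ⊤ : Submodule R (R ⧸ q)) ≤ LinearMap.ker f := by
    rintro _ ⟨y, -, rfl⟩
    obtain ⟨y, rfl⟩ := Ideal.Quotient.mk_surjective y
    change f (Ideal.Quotient.mk q (a * y)) = 0
    exact Ideal.Quotient.eq_zero_iff_mem.mpr (Ideal.mul_mem_right _ _ haq')
  exact supportDim_le_of_surjective (Submodule.liftQ _ f hf) fun y => by
    obtain ⟨y, rfl⟩ := Ideal.Quotient.mk_surjective y
    exact ⟨Submodule.Quotient.mk (Ideal.Quotient.mk q y), rfl⟩

/-- The depth of a module is at most the dimension of each of its associated primes. -/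
theorem DepthGE.le_ringKrullDim_quotient {h : ℕ} (H : DepthGE R M h) {q : Ideal R}
    (hq : IsAssociatedPrime q M) : (h : WithBot ℕ∞) ≤ ringKrullDim (R ⧸ q) := by
  obtain ⟨rs, rfl, hmem, hreg⟩ := H
  induction rs generalizing M q with
  | nil =>
    have := hq.isPrime
    simpa using ringKrullDim_nonneg_of_nontrivial
  | cons a rs ih =>
    rw [isRegular_cons_iff] at hreg
    obtain ⟨ha, hreg⟩ := hreg
    have ham : a ∈ maximalIdeal R := hmem a (by simp)
    have hqp := hq.isPrime
    obtain ⟨-, x, hx⟩ := isAssociatedPrime_iff.mp hq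
    have hmemq : ∀ r, r ∈ q ↔ r • x = 0 := fun r => by rw [hx]; simp [Submodule.mem_colon_singleton]
    have hx0 : x ≠ 0 := by
      rintro rfl
      exact hqp.ne_top ((Ideal.eq_top_iff_one _).mpr ((hmemq 1).mpr (by simp)))
    have haq : a ∉ q := fun h => hx0 (ha.right_eq_zero_of_smul ((hmemq a).mp h))
    let N : Submodule R M := Submodule.torsionBySet R M q
    have hN : ∀ u, u ∈ N ↔ ∀ r ∈ q, r • u = 0 := fun u => by
      simp [N, Submodule.mem_torsionBySet_iff]
    obtain ⟨u, huN, hua⟩ : ∃ u ∈ N, u ∉ (a • ⊤ : Submodule R M) := by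
      by_contra! hle
      have hNa : N ≤ maximalIdeal R • N := fun u hu => by
        obtain ⟨u', -, rfl⟩ := hle u hu
        refine Submodule.smul_mem_smul ham ((hN u').mpr fun r hr => ?_)
        refine ha.right_eq_zero_of_smul ?_
        rw [smul_comm]
        exact (hN _).mp hu r hr
      have := Submodule.eq_bot_of_le_smul_of_le_jacobson_bot (maximalIdeal R) N
        (IsNoetherian.noetherian N) hNa (maximalIdeal_le_jacobson _)
      exact hx0 ((Submodule.mem_bot R).mp (this ▸ (hN x).mpr fun r hr => (hmemq r).mp hr))
    obtain ⟨q', hq', hle⟩ := exists_le_isAssociatedPrime_of_isNoetherianRing R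
      (Submodule.Quotient.mk u : QuotSMulTop a M) (by simpa using hua)
    have hq'p := hq'.isPrime
    have hlt : q < q' := by
      refine lt_of_le_of_ne (fun r hr => hle ?_) fun h => haq (h ▸ hle ?_)
      · rw [Submodule.mem_colon_singleton, ← Submodule.Quotient.mk_smul, (hN u).mp huN r hr]
        simp
      · rw [Submodule.mem_colon_singleton, ← Submodule.Quotient.mk_smul, Submodule.mem_bot,
          Submodule.Quotient.mk_eq_zero]
        exact Submodule.smul_mem_pointwise_smul _ _ _ trivial
    have h1 := ih hq' (fun r hr => hmem r (by simp [hr])) hreg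
    calc ((a :: rs).length : WithBot ℕ∞) = rs.length + 1 := by simp
      _ ≤ ringKrullDim (R ⧸ q') + 1 := by gcongr
      _ ≤ _ := ringKrullDim_quotient_succ_le_of_lt hlt

theorem supportDim_le_supportDim_quotient_add_length (fs : List R)
    (hfs : ∀ f ∈ fs, f ∈ maximalIdeal R) :
    supportDim R M ≤ supportDim R (M ⧸ Ideal.ofList fs • (⊤ : Submodule R M)) + fs.length := by
  induction fs generalizing M with
  | nil =>
    rw [Ideal.ofList_nil, Submodule.bot_smul]
    simp [supportDim_eq_of_equiv (Submodule.quotEquivOfEqBot (⊥ : Submodule R M) rfl)]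
  | cons f fs ih =>
    rw [supportDim_eq_of_equiv (Submodule.quotOfListConsSMulTopEquivQuotSMulTopInner M f fs)]
    calc supportDim R M ≤ supportDim R (QuotSMulTop f M) + 1 :=
          supportDim_le_supportDim_quotSMulTop_succ (hfs f (by simp))
      _ ≤ (_ + fs.length) + 1 := by
          gcongr
          exact ih fun f' hf' => hfs f' (by simp [hf'])
      _ = _ := by rw [add_assoc]; simp

/-- Dividing by `fs` lowers the depth by at most the length of `fs`, if it lowers the dimension as
much as possible. -/
theorem DepthGE.quotient_ofList (fs : List R) (hfs : ∀ f ∈ fs, f ∈ maximalIdeal R) {h : ℕ}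
    (H : DepthGE R M (h + fs.length))
    (hdim : supportDim R (M ⧸ Ideal.ofList fs • (⊤ : Submodule R M)) ≤ h) :
    DepthGE R (M ⧸ Ideal.ofList fs • (⊤ : Submodule R M)) h := by
  induction fs generalizing M with
  | nil =>
    refine DepthGE.congr (Submodule.quotEquivOfEqBot _ ?_).symm H
    rw [Ideal.ofList_nil, Submodule.bot_smul]
  | cons f fs ih =>
    have hf : f ∈ maximalIdeal R := hfs f (by simp)
    have hfs' : ∀ f ∈ fs, f ∈ maximalIdeal R := fun f' hf' => hfs f' (by simp [hf'])
    have e := Submodule.quotOfListConsSMulTopEquivQuotSMulTopInner M f fs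
    rw [supportDim_eq_of_equiv e] at hdim
    refine DepthGE.congr e.symm (ih hfs' (DepthGE.quotSMulTop (by simpa [add_assoc] using H) hf ?_)
      hdim)
    by_contra hreg
    have hreg' : f ∈ ⋃ p ∈ associatedPrimes R M, (p : Set R) := by
      rw [biUnion_associatedPrimes_eq_compl_regular]
      exact hreg
    simp only [Set.mem_iUnion] at hreg'
    obtain ⟨q, hq, hfq⟩ := hreg'
    have h1 := H.le_ringKrullDim_quotient hq
    have hqs : ringKrullDim (R ⧸ q) ≤ supportDim R (QuotSMulTop f M) := by
      have hqp := hq.isPrime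
      have hqM : (⟨q, hqp⟩ : PrimeSpectrum R) ∈ support R M := by
        rw [mem_support_iff_of_finite, ← Submodule.annihilator_top]
        exact hq.annihilator_le
      have hqM' : (⟨q, hqp⟩ : PrimeSpectrum R) ∈ support R (QuotSMulTop f M) := by
        rw [support_quotSMulTop]
        exact ⟨hqM, by simpa using hfq⟩
      rw [mem_support_iff_of_finite] at hqM'
      rw [supportDim_eq_ringKrullDim_quotient_annihilator]
      exact ringKrullDim_le_of_surjective (Ideal.Quotient.factor hqM')
        (Ideal.Quotient.factor_surjective hqM')
    have h2 := supportDim_le_supportDim_quotient_add_length (M := QuotSMulTop f M) fs hfs'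
    have h3 : ((h + (f :: fs).length : ℕ) : WithBot ℕ∞) ≤ ((h + fs.length : ℕ) : WithBot ℕ∞) :=
      calc _ ≤ _ := h1.trans (hqs.trans h2)
        _ ≤ (h : WithBot ℕ∞) + fs.length := by gcongr
        _ = _ := by simp
    have h4 : h + (f :: fs).length ≤ h + fs.length := by exact_mod_cast h3
    simp at h4

end Depth

end ProjVar

end

noncomputable section

namespace ProjVar

section CompleteIntersection

open IsLocalRing RingTheory.Sequence Module Pointwise MvPolynomial

universe u

theorem height_add_ringKrullDim_quotient_le {R : Type*} [CommRing R] (I : Ideal R)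
    [hI : I.IsPrime] :
    (I.height : WithBot ℕ∞) + ringKrullDim (R ⧸ I) ≤ ringKrullDim R := by
  let p : PrimeSpectrum R := ⟨I, hI⟩
  have h1 : I.height = Order.height p := PrimeSpectrum.height_eq_orderHeight p
  have h2 : ringKrullDim (R ⧸ I) = Order.coheight p := by
    rw [ringKrullDim_quotient, Order.coheight_eq_krullDim_Ici]
    congr
  have : Nonempty (PrimeSpectrum R) := ⟨p⟩
  rw [h1, h2, ringKrullDim, Order.krullDim_eq_iSup_height_add_coheight_of_nonempty]
  exact_mod_cast le_iSup (fun a : PrimeSpectrum R => Order.height a + Order.coheight a) p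

/-- If `I` is a prime ideal of height at least `r` which is generated by `r` elements, and the
depth at the maximal ideal `m` is at least `r + 2`, then `m` is not associated to `I + (l)` for
`l ∉ I`. -/
theorem mem_sup_span_of_forall_mul_mem {P : Type u} [CommRing P] [IsNoetherianRing P]
    (m : Ideal P) [hm : m.IsMaximal] {N r : ℕ}
    (hdepth : DepthGE (Localization.AtPrime m) (Localization.AtPrime m) N)
    (hN : ringKrullDim P ≤ N) {I : Ideal P} [hI : I.IsPrime] (hIm : I ≤ m) (f : Fin r → P)
    (hf : I = Ideal.span (Set.range f)) (hht : (r : ℕ∞) ≤ I.height) (hr : r + 2 ≤ N)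
    {l : P} (hlm : l ∈ m) (hl : l ∉ I) {a : P} (ha : ∀ p ∈ m, p * a ∈ I ⊔ Ideal.span {l}) :
    a ∈ I ⊔ Ideal.span {l} := by
  let R := Localization.AtPrime m
  let ι : P →+* R := algebraMap P R
  have hdisj : Disjoint (m.primeCompl : Set P) (I : Set P) :=
    Set.disjoint_left.mpr fun x hx hxI => hx (hIm hxI)
  have hJp : (I.map ι).IsPrime :=
    IsLocalization.isPrime_of_isPrime_disjoint m.primeCompl R I hI hdisj
  let fs : List R := List.ofFn (ι ∘ f)
  have hfs : Ideal.ofList fs = I.map ι := by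
    rw [hf, Ideal.map_span, ← Set.range_comp]
    change Ideal.span {x | x ∈ fs} = _
    congr 1
    ext x
    simp [fs]
  have hsmul : (Ideal.ofList fs • ⊤ : Submodule R R) = I.map ι := by
    rw [hfs]; simp
  have hιm : ∀ p ∈ m, ι p ∈ maximalIdeal R := fun p hp =>
    (IsLocalization.AtPrime.to_map_mem_maximal_iff R m p).mpr hp
  have hfm : ∀ x ∈ fs, x ∈ maximalIdeal R := by
    intro x hx
    obtain ⟨i, rfl⟩ := (List.mem_ofFn' _ _).mp hx
    exact hιm _ (hIm (hf ▸ Ideal.subset_span ⟨i, rfl⟩))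
  have hlen : fs.length = r := by simp [fs]
  have hdim : supportDim R (R ⧸ (Ideal.ofList fs • ⊤ : Submodule R R)) ≤ (N - r : ℕ) := by
    rw [hsmul, supportDim_quotient_eq_ringKrullDim]
    have h1 := height_add_ringKrullDim_quotient_le (I.map ι)
    have h2 : (I.map ι).height = I.height :=
      IsLocalization.height_map_of_disjoint m.primeCompl I hdisj
    rw [h2] at h1
    have h3 : ringKrullDim R ≤ N := by
      rw [IsLocalization.AtPrime.ringKrullDim_eq_height m R]
      exact (Ideal.height_le_ringKrullDim_of_ne_top hm.ne_top).trans hN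
    have h4 : (r : WithBot ℕ∞) + ringKrullDim (R ⧸ I.map ι) ≤ N :=
      le_trans (by gcongr; exact_mod_cast hht) (h1.trans h3)
    have hnt : 0 ≤ ringKrullDim (R ⧸ I.map ι) := ringKrullDim_nonneg_of_nontrivial
    generalize ringKrullDim (R ⧸ I.map ι) = D at h4 hnt ⊢
    induction D with
    | bot => exact absurd hnt (by simp)
    | coe D =>
      have h5 : (r : ℕ∞) + D ≤ N := WithBot.coe_le_coe.mp h4
      refine WithBot.coe_le_coe.mpr ?_
      induction D using ENat.recTopCoe with
      | top => simp at h5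
      | coe D =>
        have h6 : r + D ≤ N := by exact_mod_cast h5
        have h7 : D ≤ N - r := by omega
        exact_mod_cast h7
  have H : DepthGE R (R ⧸ (Ideal.ofList fs • ⊤ : Submodule R R)) (N - r) :=
    DepthGE.quotient_ofList fs hfm (by rw [hlen, Nat.sub_add_cancel (by omega)]; exact hdepth) hdim
  obtain ⟨c, hc⟩ : ∃ c, N - r = c + 1 + 1 := ⟨N - r - 2, by omega⟩
  rw [hc, hsmul] at H
  have hιl : ι l ∉ I.map ι := by
    rw [IsLocalization.algebraMap_mem_map_algebraMap_iff m.primeCompl]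
    rintro ⟨s, hs, hsl⟩
    exact (hI.mem_or_mem hsl).elim (fun h => hs (hIm h)) hl
  have H' := H.quotSMulTop (hιm l hlm) (by
    rw [isSMulRegular_quotient_iff_mem_of_smul_mem]
    exact fun x hx => (hJp.mem_or_mem hx).resolve_left hιl)
  have hsup : ∀ p ∈ I ⊔ Ideal.span {l},
      (Submodule.Quotient.mk (Ideal.Quotient.mk (I.map ι) (ι p)) :
        QuotSMulTop (ι l) (R ⧸ I.map ι)) = 0 := by
    intro p hp
    obtain ⟨i, hi, j, hj, rfl⟩ := Submodule.mem_sup.mp hp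
    obtain ⟨d, rfl⟩ := Ideal.mem_span_singleton'.mp hj
    rw [Submodule.Quotient.mk_eq_zero, map_add, map_add,
      Ideal.Quotient.eq_zero_iff_mem.mpr (Ideal.mem_map_of_mem ι hi), zero_add, map_mul,
      mul_comm, map_mul]
    exact Submodule.smul_mem_pointwise_smul (Ideal.Quotient.mk _ (ι d)) (ι l) ⊤ trivial
  have hx := H'.eq_zero_of_maximalIdeal_smul_eq_zero
    (Submodule.Quotient.mk (Ideal.Quotient.mk _ (ι a))) (by
      let K : Ideal R := LinearMap.ker (LinearMap.toSpanSingleton R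
        (QuotSMulTop (ι l) (R ⧸ I.map ι)) (Submodule.Quotient.mk (Ideal.Quotient.mk _ (ι a))))
      have hK : m.map ι ≤ K := by
        rw [Ideal.map_le_iff_le_comap]
        intro p hp
        have h1 := hsup _ (ha p hp)
        rw [map_mul] at h1
        exact h1
      intro t ht
      rw [← Localization.AtPrime.map_eq_maximalIdeal] at ht
      exact hK ht)
  rw [Submodule.Quotient.mk_eq_zero] at hx
  obtain ⟨y, -, hy⟩ := hx
  obtain ⟨y, rfl⟩ := Ideal.Quotient.mk_surjective y
  have hmem : ι a ∈ (I ⊔ Ideal.span {l}).map ι := by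
    have h1 : ι a - ι l * y ∈ I.map ι := by
      rw [← Ideal.Quotient.eq_zero_iff_mem, map_sub, ← hy, sub_eq_zero]
      rfl
    rw [Ideal.map_sup, Ideal.map_span, Set.image_singleton]
    rw [← sub_add_cancel (ι a) (ι l * y)]
    exact Submodule.add_mem_sup h1 (Ideal.mul_mem_right _ _ (Ideal.mem_span_singleton_self _))
  rw [IsLocalization.algebraMap_mem_map_algebraMap_iff m.primeCompl] at hmem
  obtain ⟨s, hs, hsa⟩ := hmem
  obtain ⟨y, hy⟩ := hm.exists_inv hs
  obtain ⟨i, hi, hyi⟩ := hy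
  have : a = y * (s * a) + i * a := by rw [← mul_assoc, ← add_mul, hyi, one_mul]
  rw [this]
  exact add_mem (Ideal.mul_mem_left _ _ hsa) (ha i hi)

variable {k : Type u} [Field k] {n : ℕ}

theorem mem_idealOfVars_iff {σ : Type*} {p : MvPolynomial σ k} :
    p ∈ idealOfVars σ k ↔ constantCoeff p = 0 := by
  rw [← pow_one (idealOfVars σ k), mem_pow_idealOfVars_iff']
  simp only [Nat.lt_one_iff, Finsupp.degree_eq_zero_iff, forall_eq, constantCoeff_eq]

instance isMaximal_idealOfVars {σ : Type*} : (idealOfVars σ k).IsMaximal := by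
  have : idealOfVars σ k = RingHom.ker (constantCoeff : MvPolynomial σ k →+* k) := by
    ext p; rw [mem_idealOfVars_iff, RingHom.mem_ker]
  rw [this]
  exact RingHom.ker_isMaximal_of_surjective _ fun x => ⟨C x, constantCoeff_C _ x⟩

theorem mem_span_X_image_of_X_mul_mem {σ : Type*} {s : Set σ} {i : σ} (hi : i ∉ s)
    {u : MvPolynomial σ k} (hu : X i * u ∈ Ideal.span (X '' s : Set (MvPolynomial σ k))) :
    u ∈ Ideal.span (X '' s : Set (MvPolynomial σ k)) := by
  classical
  rw [mem_ideal_span_X_image] at hu ⊢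
  intro d hd
  obtain ⟨j, hj, hne⟩ := hu (Finsupp.single i 1 + d) (by
    rw [MvPolynomial.mem_support_iff, coeff_X_mul]
    exact MvPolynomial.mem_support_iff.mp hd)
  have hij : i ≠ j := fun h => hi (h ▸ hj)
  exact ⟨j, hj, by simpa [hij] using hne⟩

theorem isWeaklyRegular_X :
    IsWeaklyRegular (MvPolynomial (Fin n) k) (List.ofFn (X : Fin n → MvPolynomial (Fin n) k)) := by
  refine ⟨fun i hi => ?_⟩
  have hi' : i < n := by simpa using hi
  have hs : (Ideal.ofList ((List.ofFn (X : Fin n → MvPolynomial (Fin n) k)).take i) • ⊤ :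
      Submodule (MvPolynomial (Fin n) k) (MvPolynomial (Fin n) k)) =
      Ideal.span (X '' {j : Fin n | (j : ℕ) < i}) := by
    rw [smul_eq_mul, Ideal.mul_top]
    change Ideal.span {p | p ∈ (List.ofFn (X : Fin n → MvPolynomial (Fin n) k)).take i} = _
    congr 1
    ext p
    simp only [Set.mem_ofPred_eq, Set.mem_image, List.mem_take_iff_getElem, List.getElem_ofFn,
      List.length_ofFn]
    constructor
    · rintro ⟨j, hj, rfl⟩
      exact ⟨⟨j, by omega⟩, by simp; omega, rfl⟩
    · rintro ⟨j, hj, rfl⟩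
      exact ⟨j, by omega, rfl⟩
  rw [hs, isSMulRegular_quotient_iff_mem_of_smul_mem]
  intro u hu
  rw [List.getElem_ofFn] at hu
  exact mem_span_X_image_of_X_mul_mem (by simp) hu

theorem depthGE_localization_idealOfVars :
    DepthGE (Localization.AtPrime (idealOfVars (Fin n) k))
      (Localization.AtPrime (idealOfVars (Fin n) k)) n := by
  have hmem : ∀ r ∈ List.ofFn (X : Fin n → MvPolynomial (Fin n) k), r ∈ idealOfVars (Fin n) k := by
    intro r hr
    obtain ⟨i, rfl⟩ := (List.mem_ofFn' _ _).mp hr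
    exact Ideal.subset_span ⟨i, rfl⟩
  refine ⟨_, ?_, ?_, isWeaklyRegular_X.isRegular_of_isLocalization_of_mem
    (Localization.AtPrime (idealOfVars (Fin n) k)) (idealOfVars (Fin n) k) hmem⟩
  · simp
  · intro r hr
    obtain ⟨p, hp, rfl⟩ := List.mem_map.mp hr
    exact (IsLocalization.AtPrime.to_map_mem_maximal_iff _ (idealOfVars (Fin n) k) p).mpr
      (hmem p hp)

theorem ringKrullDim_mvPolynomial_fin : ringKrullDim (MvPolynomial (Fin n) k) = n := by
  rw [MvPolynomial.ringKrullDim_of_isNoetherianRing, ringKrullDim_eq_zero_of_field]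
  simp

/-- The homogeneous coordinate ring of a positive dimensional complete intersection has depth at
least two at the vertex. -/
theorem mem_sup_span_of_forall_X_mul_mem {r : ℕ} {I : Ideal (MvPolynomial (Fin n) k)}
    [I.IsPrime] (hIm : I ≤ idealOfVars (Fin n) k) (f : Fin r → MvPolynomial (Fin n) k)
    (hf : I = Ideal.span (Set.range f)) (hht : (r : ℕ∞) ≤ I.height) (hr : r + 2 ≤ n)
    {l : MvPolynomial (Fin n) k} (hlm : l ∈ idealOfVars (Fin n) k) (hl : l ∉ I)
    {a : MvPolynomial (Fin n) k} (ha : ∀ i, X i * a ∈ I ⊔ Ideal.span {l}) :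
    a ∈ I ⊔ Ideal.span {l} := by
  refine mem_sup_span_of_forall_mul_mem (idealOfVars (Fin n) k) depthGE_localization_idealOfVars
    ringKrullDim_mvPolynomial_fin.le hIm f hf hht hr hlm hl fun p hp => ?_
  rw [← smul_eq_mul, ← Submodule.mem_colon_singleton]
  revert p
  change idealOfVars (Fin n) k ≤ _
  rw [idealOfVars, Ideal.span_le]
  rintro _ ⟨i, rfl⟩
  exact Submodule.mem_colon_singleton.mpr (ha i)

end CompleteIntersection

end ProjVar

end

noncomputable section

namespace ProjVar

open MvPolynomial

section Scaling

variable {k : Type*} [Field k] {σ : Type*}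

theorem eval₂_mul_of_isHomogeneous {R S : Type*} [CommSemiring R] [CommSemiring S] (f : R →+* S)
    {F : MvPolynomial σ R} {e : ℕ} (hF : F.IsHomogeneous e) (t : S) (y : σ → S) :
    eval₂ f (fun i => t * y i) F = t ^ e * eval₂ f y F := by
  rw [eval₂_eq, eval₂_eq, Finset.mul_sum]
  refine Finset.sum_congr rfl fun d hd => ?_
  have hdeg : ∑ i ∈ d.support, d i = e := by
    have := hF.degree_eq_sum_deg_support hd
    rw [this]
  simp only [mul_pow, Finset.prod_mul_distrib, Finset.prod_pow_eq_pow_sum, hdeg]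
  ring

theorem eval_smul_of_isHomogeneous {F : MvPolynomial σ k} {e : ℕ} (hF : F.IsHomogeneous e) (t : k)
    (v : σ → k) : eval (t • v) F = t ^ e * eval v F :=
  eval₂_mul_of_isHomogeneous (RingHom.id k) hF t v

theorem zpow_finset_sum {G ι : Type*} [CommGroup G] (t : G) (s : Finset ι) (f : ι → ℤ) :
    t ^ (∑ i ∈ s, f i) = ∏ i ∈ s, t ^ f i := by
  classical
  induction s using Finset.induction_on with
  | empty => simp
  | insert a s ha ih => rw [Finset.sum_insert ha, Finset.prod_insert ha, zpow_add, ih]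

theorem eval_zpow_mul_of_isWeightedHomogeneous {w : σ → ℤ} {F : MvPolynomial σ k} {j : ℤ}
    (hF : F.IsWeightedHomogeneous w j) (t : kˣ) (v : σ → k) :
    eval (fun i => ((t ^ w i : kˣ) : k) * v i) F = ((t ^ j : kˣ) : k) * eval v F := by
  rw [eval_eq, eval_eq, Finset.mul_sum]
  refine Finset.sum_congr rfl fun d hd => ?_
  have hdeg : ∑ i ∈ d.support, (d i : ℤ) * w i = j := by
    have := hF (mem_support_iff.mp hd)
    simpa [Finsupp.weight_apply, Finsupp.sum] using this
  have : ∏ i ∈ d.support, ((t ^ w i : kˣ) : k) ^ d i = ((t ^ j : kˣ) : k) := by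
    rw [← hdeg]
    simp only [← Units.val_pow_eq_pow_val]
    rw [← Units.coe_prod]
    congr 1
    rw [zpow_finset_sum]
    refine Finset.prod_congr rfl fun i _ => ?_
    rw [mul_comm, zpow_mul, zpow_natCast]
  simp only [mul_pow, Finset.prod_mul_distrib, this]
  ring

theorem homogeneousComponent_eq_weighted (d : ℕ) (f : MvPolynomial σ k) :
    homogeneousComponent d f = weightedHomogeneousComponent (fun _ => (1 : ℤ)) (d : ℤ) f := by
  classical
  ext m
  rw [coeff_homogeneousComponent, coeff_weightedHomogeneousComponent]
  have : Finsupp.weight (fun _ : σ => (1 : ℤ)) m = (m.degree : ℤ) := by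
    simp [Finsupp.weight_apply, Finsupp.sum, Finsupp.degree_apply]
  simp [this]

variable [IsAlgClosed k]

theorem zpow_eq_zero_of_forall {j : ℤ} (h : ∀ t : kˣ, t ^ j = 1) : j = 0 := by
  have hinf : Infinite k := IsAlgClosed.instInfinite
  by_contra hj
  obtain ⟨a, ha⟩ : ∃ a : k, a ≠ 0 ∧ a ≠ 1 := by
    obtain ⟨a, ha⟩ := ((Set.finite_singleton (1 : k)).insert 0).infinite_compl.nonempty
    exact ⟨a, by simpa using ha⟩
  obtain ⟨b, hb⟩ := IsAlgClosed.exists_pow_nat_eq a (Int.natAbs_pos.mpr hj)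
  have hb0 : b ≠ 0 := by
    rintro rfl
    exact ha.1 (by rw [← hb, zero_pow (Int.natAbs_pos.mpr hj).ne'])
  have h1 := h (Units.mk0 b hb0)
  have h2 : (Units.mk0 b hb0) ^ j.natAbs = 1 := by
    rcases Int.natAbs_eq j with h' | h'
    · rw [h', zpow_natCast] at h1; simpa using h1
    · rw [h', zpow_neg, zpow_natCast, inv_eq_one] at h1; simpa using h1
  exact ha.2 (by rw [← hb]; simpa using congrArg Units.val h2)

theorem eq_zero_of_forall_sum_zpow_mul {s : Finset ℤ} {c : ℤ → k}
    (H : ∀ t : kˣ, ∑ j ∈ s, ((t ^ j : kˣ) : k) * c j = 0) {j : ℤ} (hj : j ∈ s) : c j = 0 := by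
  let χ : ℤ → kˣ →* k := fun j => (Units.coeHom k).comp (zpowGroupHom j)
  have hχ : Function.Injective χ := by
    intro i j hij
    rw [← sub_eq_zero]
    refine zpow_eq_zero_of_forall (k := k) fun t => ?_
    have : t ^ i = t ^ j := Units.ext (DFunLike.congr_fun hij t)
    rw [zpow_sub, this, mul_inv_cancel]
  have hli := (linearIndependent_monoidHom kˣ k).comp χ hχ
  refine linearIndependent_iff'.mp hli s c ?_ j hj
  funext t
  simpa [χ, mul_comm] using H t

/-- If `f` vanishes on the orbit of `v` under a one-parameter torus, then its weighted homogeneous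
components vanish at `v`. -/
theorem eval_weightedHomogeneousComponent_eq_zero {w : σ → ℤ} {f : MvPolynomial σ k} {v : σ → k}
    (H : ∀ t : kˣ, eval (fun i => ((t ^ w i : kˣ) : k) * v i) f = 0) (j : ℤ) :
    eval v (weightedHomogeneousComponent w j f) = 0 := by
  have hfin := weightedHomogeneousComponent_finsupp (w := w) f
  by_cases hj : weightedHomogeneousComponent w j f = 0
  · rw [hj, map_zero]
  have hj' : j ∈ hfin.toFinset := hfin.mem_toFinset.mpr hj
  refine eq_zero_of_forall_sum_zpow_mul (c := fun j => eval v (weightedHomogeneousComponent w j f))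
    (fun t => ?_) hj'
  have h1 := sum_weightedHomogeneousComponent w f
  rw [finsum_eq_sum _ hfin] at h1
  have h2 := H t
  rw [← h1, map_sum] at h2
  rw [← h2]
  exact Finset.sum_congr rfl fun j _ => (eval_zpow_mul_of_isWeightedHomogeneous
    (weightedHomogeneousComponent_isWeightedHomogeneous j f) t v).symm

theorem eval_homogeneousComponent_eq_zero {f : MvPolynomial σ k} {v : σ → k}
    (H : ∀ t : kˣ, eval ((t : k) • v) f = 0) (d : ℕ) : eval v (homogeneousComponent d f) = 0 := by
  rw [homogeneousComponent_eq_weighted]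
  refine eval_weightedHomogeneousComponent_eq_zero (fun t => ?_) _
  have := H t
  simp only [zpow_one]
  exact this

end Scaling

section Cone

variable {k : Type*} [Field k] {σ : Type*} {X : Set (ProjSpace k σ)}

theorem mk_smul_eq_mk {v : σ → k} (hv : v ≠ 0) (t : kˣ) (htv : (t : k) • v ≠ 0) :
    Projectivization.mk k ((t : k) • v) htv = Projectivization.mk k v hv := by
  rw [Projectivization.mk_eq_mk_iff]
  exact ⟨t, rfl⟩

theorem zero_mem_affineCone : (0 : σ → k) ∈ affineCone X := fun h => absurd rfl h

theorem smul_mem_affineCone {v : σ → k} (hv : v ∈ affineCone X) (t : k) :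
    t • v ∈ affineCone X := by
  intro htv
  have ht : t ≠ 0 := fun h => htv (by rw [h, zero_smul])
  have hv0 : v ≠ 0 := fun h => htv (by rw [h, smul_zero])
  rw [← Units.val_mk0 ht] at htv
  exact (mk_smul_eq_mk hv0 (Units.mk0 t ht) htv).symm ▸ hv hv0

theorem puncturedCone_subset : puncturedCone X ⊆ affineCone X := fun _ ⟨_, h⟩ _ => h

theorem mem_puncturedCone {v : σ → k} (hv : v ∈ affineCone X) (h0 : v ≠ 0) :
    v ∈ puncturedCone X := ⟨h0, hv h0⟩

theorem rep_mem_affineCone {p : ProjSpace k σ} (hp : p ∈ X) : p.rep ∈ affineCone X := fun h => by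
  rwa [Projectivization.mk_rep]

theorem mk_mem_basicOpen_iff {F : MvPolynomial σ k} {e : ℕ} (hF : F.IsHomogeneous e) {v : σ → k}
    (hv : v ≠ 0) : Projectivization.mk k v hv ∈ basicOpen F ↔ eval v F ≠ 0 := by
  obtain ⟨a, ha⟩ := Projectivization.exists_smul_eq_mk_rep k v hv
  change eval (Projectivization.mk k v hv).rep F ≠ 0 ↔ _
  rw [← ha, Units.smul_def, eval_smul_of_isHomogeneous hF]
  simp

theorem mem_homogeneousIdeal_iff {f : MvPolynomial σ k} :
    f ∈ homogeneousIdeal X ↔ ∀ v ∈ affineCone X, eval v f = 0 := Iff.rfl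

theorem homogeneousIdeal_le_idealOfVars : homogeneousIdeal X ≤ idealOfVars σ k := fun f hf => by
  rw [mem_idealOfVars_iff]
  simpa [constantCoeff_eq, eval_zero] using mem_homogeneousIdeal_iff.mp hf 0 zero_mem_affineCone

theorem homogeneousComponent_mem_homogeneousIdeal [IsAlgClosed k] {f : MvPolynomial σ k}
    (hf : f ∈ homogeneousIdeal X) (d : ℕ) : homogeneousComponent d f ∈ homogeneousIdeal X :=
  mem_homogeneousIdeal_iff.mpr fun _ hv =>
    eval_homogeneousComponent_eq_zero (fun t => hf _ (smul_mem_affineCone hv t)) d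

theorem mem_homogeneousIdeal_of_components {f : MvPolynomial σ k}
    (hf : ∀ d, homogeneousComponent d f ∈ homogeneousIdeal X) : f ∈ homogeneousIdeal X := by
  rw [← sum_homogeneousComponent f]
  exact Ideal.sum_mem _ fun d _ => hf d

theorem mem_homogeneousIdeal_iff_forall_eq_zero {f : MvPolynomial σ k} {e : ℕ}
    (hf : f.IsHomogeneous e) (hX : X.Nonempty) :
    f ∈ homogeneousIdeal X ↔ ∀ p ∈ X, eval p.rep f = 0 := by
  refine ⟨fun h p hp => h _ (rep_mem_affineCone hp), fun h => ?_⟩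
  rw [mem_homogeneousIdeal_iff]
  intro v hv
  by_cases h0 : v = 0
  · subst h0
    rcases Nat.eq_zero_or_pos e with rfl | he
    · obtain ⟨p, hp⟩ := hX
      have := h p hp
      rw [← totalDegree_zero_iff_isHomogeneous, totalDegree_eq_zero_iff_eq_C] at hf
      rw [hf] at this ⊢
      simpa using this
    · have := eval_smul_of_isHomogeneous hf (0 : k) (0 : σ → k)
      rw [zero_pow he.ne'] at this
      simpa using this
  · by_contra hne
    exact (mk_mem_basicOpen_iff hf h0).mpr hne (h _ (hv h0))

theorem exists_form_of_notMem_of_isClosed (hX : IsClosed X) {p : ProjSpace k σ} (hp : p ∉ X) :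
    ∃ (F : MvPolynomial σ k) (e : ℕ), F.IsHomogeneous e ∧ p ∈ basicOpen F ∧
      Disjoint (basicOpen F) X := by
  have hbasis : TopologicalSpace.IsTopologicalBasis
      {U : Set (ProjSpace k σ) | ∃ (F : MvPolynomial σ k) (d : ℕ), F.IsHomogeneous d ∧
        U = basicOpen F} := by
    refine ⟨?_, ?_, rfl⟩
    · rintro _ ⟨F, d, hF, rfl⟩ _ ⟨G, e, hG, rfl⟩ q hq
      refine ⟨basicOpen (F * G), ⟨F * G, d + e, hF.mul hG, rfl⟩, ?_, ?_⟩
      · simpa [basicOpen] using hq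
      · intro q hq
        simpa [basicOpen] using hq
    · refine Set.eq_univ_of_forall fun q => ⟨basicOpen 1, ⟨1, 0, isHomogeneous_one _ _, rfl⟩, ?_⟩
      simp [basicOpen]
  obtain ⟨_, ⟨F, e, hF, rfl⟩, hpF, hsub⟩ :=
    hbasis.exists_subset_of_mem_open (show p ∈ Xᶜ from hp) hX.isOpen_compl
  exact ⟨F, e, hF, hpF, Set.disjoint_left.mpr fun q hq hqX => hsub hq hqX⟩

theorem isOpen_basicOpen {F : MvPolynomial σ k} {e : ℕ} (hF : F.IsHomogeneous e) :
    IsOpen (basicOpen F) := TopologicalSpace.isOpen_generateFrom_of_mem ⟨F, e, hF, rfl⟩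

theorem zeroLocus_homogeneousIdeal (hX : IsClosed X) (hne : X.Nonempty) :
    zeroLocus k (homogeneousIdeal X) = affineCone X := by
  refine le_antisymm (fun v hv h0 => ?_) (zeroLocus_vanishingIdeal_le _)
  by_contra hp
  obtain ⟨F, e, hF, hpF, hd⟩ := exists_form_of_notMem_of_isClosed hX hp
  refine (mk_mem_basicOpen_iff hF h0).mp hpF (hv F ?_)
  rw [mem_homogeneousIdeal_iff_forall_eq_zero hF hne]
  intro q hq
  by_contra hne
  exact Set.disjoint_left.mp hd hne hq

theorem isPrime_homogeneousIdeal [IsAlgClosed k] (hX : IsIrreducible X) :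
    (homogeneousIdeal X).IsPrime := by
  let := gradedAlgebra (σ := σ) (R := k)
  have hhom : (homogeneousIdeal X).IsHomogeneous (homogeneousSubmodule σ k) := by
    intro i f hf
    have := homogeneousComponent_mem_homogeneousIdeal hf i
    rwa [← decomposition.decompose'_apply] at this
  refine hhom.isPrime_of_homogeneous_mem_or_mem ?_ ?_
  · exact fun h => (isMaximal_idealOfVars (k := k) (σ := σ)).ne_top
      (top_le_iff.mp (h ▸ homogeneousIdeal_le_idealOfVars))
  · rintro f g ⟨d, hf⟩ ⟨e, hg⟩ hfg
    by_contra! hne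
    rw [mem_homogeneousIdeal_iff_forall_eq_zero hf hX.nonempty,
      mem_homogeneousIdeal_iff_forall_eq_zero hg hX.nonempty] at hne
    push Not at hne
    obtain ⟨⟨p, hp, hpf⟩, q, hq, hqg⟩ := hne
    obtain ⟨x, hx, hxf, hxg⟩ := hX.isPreirreducible _ _ (isOpen_basicOpen hf) (isOpen_basicOpen hg)
      ⟨p, hp, hpf⟩ ⟨q, hq, hqg⟩
    have h0 := hfg _ (rep_mem_affineCone hx)
    rw [map_mul] at h0
    exact mul_ne_zero hxf hxg h0

end Cone

end ProjVar

end

noncomputable section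

namespace ProjVar

open MvPolynomial

section Codimension

variable {k : Type*} [Field k] {σ : Type*}

theorem homogeneousIdeal_anti {X Y : Set (ProjSpace k σ)} (h : X ⊆ Y) :
    homogeneousIdeal Y ≤ homogeneousIdeal X :=
  vanishingIdeal_anti_mono fun _ hv h0 => h (hv h0)

theorem le_of_homogeneousIdeal_le {V W : IrreducibleCloseds (ProjSpace k σ)}
    (h : homogeneousIdeal (W : Set (ProjSpace k σ)) ≤ homogeneousIdeal (V : Set (ProjSpace k σ))) :
    V ≤ W := by
  intro p hp
  have h1 : p.rep ∈ zeroLocus k (homogeneousIdeal (W : Set (ProjSpace k σ))) :=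
    fun f hf => h hf _ (rep_mem_affineCone hp)
  rw [zeroLocus_homogeneousIdeal (X := (W : Set (ProjSpace k σ))) W.isClosed'
    W.isIrreducible'.nonempty] at h1
  have h2 := h1 p.rep_nonzero
  rwa [Projectivization.mk_rep] at h2

theorem notMem_closure_singleton {p q : ProjSpace k σ} (hpq : p ≠ q) :
    q ∉ closure ({p} : Set (ProjSpace k σ)) := by
  obtain ⟨i, hi⟩ := Function.ne_iff.mp p.rep_nonzero
  obtain ⟨j, hj⟩ : ∃ j, p.rep i * q.rep j ≠ p.rep j * q.rep i := by
    by_contra! h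
    refine hpq ?_
    rw [← p.mk_rep, ← q.mk_rep, eq_comm, Projectivization.mk_eq_mk_iff']
    refine ⟨q.rep i / p.rep i, funext fun j => ?_⟩
    simp only [Pi.smul_apply, smul_eq_mul]
    rw [div_mul_eq_mul_div, div_eq_iff hi, mul_comm, ← h j, mul_comm]
  let L : MvPolynomial σ k := C (p.rep i) * X j - C (p.rep j) * X i
  have hL : L.IsHomogeneous 1 := (isHomogeneous_C_mul_X _ _).sub (isHomogeneous_C_mul_X _ _)
  rw [mem_closure_iff]
  intro h
  obtain ⟨x, hx, rfl⟩ := h (basicOpen L) (isOpen_basicOpen hL) (by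
    simpa [basicOpen, L, sub_eq_zero] using hj)
  exact hx (by simp [L, mul_comm])

variable [IsAlgClosed k]

/-- The homogeneous ideal of a variety, as a point of the spectrum of the polynomial ring. -/
def primeOfVariety (V : IrreducibleCloseds (ProjSpace k σ)) : PrimeSpectrum (MvPolynomial σ k) :=
  ⟨homogeneousIdeal (V : Set (ProjSpace k σ)), isPrime_homogeneousIdeal V.isIrreducible'⟩

theorem strictMono_primeOfVariety :
    StrictMono fun V : IrreducibleCloseds (ProjSpace k σ) =>
      OrderDual.toDual (primeOfVariety V) := by
  intro V W hVW
  refine lt_of_le_not_ge (homogeneousIdeal_anti hVW.le) fun h => ?_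
  exact hVW.not_ge (le_of_homogeneousIdeal_le h)

theorem codim_le_height (V : IrreducibleCloseds (ProjSpace k σ)) :
    codim V ≤ (homogeneousIdeal (V : Set (ProjSpace k σ))).height := by
  have h := Order.coheight_le_coheight_apply_of_strictMono _ strictMono_primeOfVariety V
  rw [Order.coheight_toDual, ← PrimeSpectrum.height_eq_orderHeight] at h
  exact h

theorem codim_add_two_le {n : ℕ} (V : IrreducibleCloseds (ProjSpace k (Fin n))) (hV : 0 < dim V) :
    codim V + 2 ≤ n := by
  obtain ⟨p, hp, q, hq, hpq⟩ : ∃ p ∈ V, ∃ q ∈ V, p ≠ q := by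
    by_contra! h
    have : Subsingleton (V : Set (ProjSpace k (Fin n))) :=
      ⟨fun a b => Subtype.ext (h a a.2 b b.2)⟩
    have : Subsingleton (IrreducibleCloseds (V : Set (ProjSpace k (Fin n)))) := by
      refine ⟨fun a b => ?_⟩
      have key : ∀ c : IrreducibleCloseds (V : Set (ProjSpace k (Fin n))),
          (c : Set (V : Set (ProjSpace k (Fin n)))) = Set.univ := fun c =>
        Subsingleton.eq_univ_of_nonempty c.isIrreducible'.nonempty
      exact SetLike.coe_injective ((key a).trans (key b).symm)
    exact hV.not_ge Order.krullDim_nonpos_of_subsingleton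
  let Z : IrreducibleCloseds (ProjSpace k (Fin n)) :=
    ⟨closure {p}, isIrreducible_singleton.closure, isClosed_closure⟩
  have hZV : Z < V := by
    refine lt_of_le_not_ge
      (closure_minimal (Set.singleton_subset_iff.mpr hp) V.isClosed') fun h => ?_
    exact notMem_closure_singleton hpq (h hq)
  have hpZ : p ∈ Z := subset_closure (Set.mem_singleton p)
  have h1 : codim V + 1 ≤ codim Z := Order.coheight_add_one_le hZV
  have h2 := codim_le_height Z
  have hprime := (primeOfVariety Z).isPrime
  have h3 : homogeneousIdeal (Z : Set (ProjSpace k (Fin n))) < idealOfVars (Fin n) k := by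
    refine lt_of_le_not_ge homogeneousIdeal_le_idealOfVars fun h =>
      p.rep_nonzero (funext fun i => ?_)
    have := h (Ideal.subset_span ⟨i, rfl⟩) _ (rep_mem_affineCone hpZ)
    simpa using this
  have : (homogeneousIdeal (Z : Set (ProjSpace k (Fin n)))).IsPrime := hprime
  have h4 := Ideal.height_add_one_le_of_lt_of_isPrime h3
  have h5 := Ideal.height_le_ringKrullDim_of_ne_top
    (isMaximal_idealOfVars (k := k) (σ := Fin n)).ne_top
  rw [ringKrullDim_mvPolynomial_fin] at h5
  have h6 : (idealOfVars (Fin n) k).height ≤ n := by exact_mod_cast h5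
  calc codim V + 2 = codim V + 1 + 1 := by rw [add_assoc, one_add_one_eq_two]
    _ ≤ (homogeneousIdeal (Z : Set (ProjSpace k (Fin n)))).height + 1 := by
        gcongr
        exact h1.trans h2
    _ ≤ n := h4.trans h6

end Codimension

section CoordRing

variable {k : Type*} [Field k] {σ : Type*}

/-- Evaluation at a point of the affine cone. -/
def evalCone {X : Set (ProjSpace k σ)} {v : σ → k} (hv : v ∈ affineCone X) :
    CoordRing X →ₐ[k] k :=
  Ideal.Quotient.liftₐ (homogeneousIdeal X) (aeval v) fun _ hf => hf v hv

@[simp]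
theorem evalCone_mk {X : Set (ProjSpace k σ)} {v : σ → k} (hv : v ∈ affineCone X)
    (f : MvPolynomial σ k) :
    evalCone hv (Ideal.Quotient.mk (homogeneousIdeal X) f) = eval v f := rfl

theorem hasEnoughPoints_coordRing (X : Set (ProjSpace k σ)) : HasEnoughPoints k (CoordRing X) := by
  intro a ha
  obtain ⟨f, rfl⟩ := Ideal.Quotient.mk_surjective a
  rw [Ideal.Quotient.eq_zero_iff_mem, mem_homogeneousIdeal_iff]
  exact fun v hv => ha (evalCone hv)

variable {I : Ideal (MvPolynomial σ k)}

theorem exists_top_component_notMem {g : MvPolynomial σ k} {a : ℕ}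
    (ha : homogeneousComponent a g ∉ I) :
    ∃ i, a ≤ i ∧ homogeneousComponent i g ∉ I ∧ ∀ j, i < j → homogeneousComponent j g ∈ I := by
  classical
  have hbound : ∀ j, homogeneousComponent j g ∉ I → j ≤ g.totalDegree := by
    intro j hj
    by_contra! h
    exact hj (by rw [homogeneousComponent_eq_zero _ _ h]; exact I.zero_mem)
  let s := (Finset.range (g.totalDegree + 1)).filter fun j => homogeneousComponent j g ∉ I
  have hs : ∀ j, j ∈ s ↔ homogeneousComponent j g ∉ I := fun j => by
    simp only [s, Finset.mem_filter, Finset.mem_range, and_iff_right_iff_imp]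
    exact fun hj => Nat.lt_succ_of_le (hbound j hj)
  have hne : s.Nonempty := ⟨a, (hs a).mpr ha⟩
  refine ⟨s.max' hne, s.le_max' _ ((hs a).mpr ha), (hs _).mp (s.max'_mem hne), fun j hj => ?_⟩
  by_contra h
  exact hj.not_ge (s.le_max' _ ((hs j).mpr h))

theorem mk_homogeneousComponent_mul {g c : MvPolynomial σ k} {i j : ℕ}
    (hg : ∀ a, i < a → homogeneousComponent a g ∈ I)
    (hc : ∀ a, j < a → homogeneousComponent a c ∈ I) :
    Ideal.Quotient.mk I (homogeneousComponent (i + j) (g * c)) =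
      Ideal.Quotient.mk I (homogeneousComponent i g * homogeneousComponent j c) := by
  have hgc : g * c = ∑ x ∈ Finset.range (g.totalDegree + 1) ×ˢ Finset.range (c.totalDegree + 1),
      homogeneousComponent x.1 g * homogeneousComponent x.2 c := by
    rw [Finset.sum_product]
    dsimp only
    rw [← Finset.sum_mul_sum, sum_homogeneousComponent,
      sum_homogeneousComponent]
  have hterm : ∀ x : ℕ × ℕ, homogeneousComponent (i + j)
      (homogeneousComponent x.1 g * homogeneousComponent x.2 c) =
      if i + j = x.1 + x.2 then homogeneousComponent x.1 g * homogeneousComponent x.2 c else 0 :=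
    fun x => homogeneousComponent_of_mem
      ((homogeneousComponent_isHomogeneous _ _).mul (homogeneousComponent_isHomogeneous _ _))
  rw [hgc, map_sum, map_sum]
  simp only [hterm]
  rw [Finset.sum_eq_single (i, j)]
  · simp
  · rintro ⟨a, b⟩ - hab
    by_cases hsum : i + j = a + b
    · rw [if_pos hsum, Ideal.Quotient.eq_zero_iff_mem]
      rcases lt_trichotomy a i with h | rfl | h
      · exact I.mul_mem_left _ (hc b (by omega))
      · exact absurd (by rw [Nat.add_left_cancel hsum]) hab
      · exact I.mul_mem_right _ (hg a h)
    · rw [if_neg hsum, map_zero]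
  · intro hnot
    rw [if_pos rfl]
    simp only [Finset.mem_product, Finset.mem_range, not_and_or, not_lt] at hnot
    rcases hnot with h | h
    · rw [homogeneousComponent_eq_zero i g (by omega)]; simp
    · rw [homogeneousComponent_eq_zero j c (by omega)]; simp

theorem homogeneousComponent_mem_of_mul_sub_mem [hI : I.IsPrime]
    (hhom : ∀ f ∈ I, ∀ d, homogeneousComponent d f ∈ I) {f g c : MvPolynomial σ k} (hg : g ∉ I)
    (h : g * c - f ∈ I) {d : ℕ} (hd : f.totalDegree < d) : homogeneousComponent d c ∈ I := by
  by_contra hcd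
  obtain ⟨j, hdj, hj, hj'⟩ := exists_top_component_notMem hcd
  obtain ⟨a, ha⟩ : ∃ a, homogeneousComponent a g ∉ I := by
    by_contra! hall
    refine hg ?_
    rw [← sum_homogeneousComponent g]
    exact Ideal.sum_mem _ fun d _ => hall d
  obtain ⟨i, -, hi, hi'⟩ := exists_top_component_notMem ha
  have h1 := hhom _ h (i + j)
  rw [map_sub, homogeneousComponent_eq_zero (i + j) f (by omega), sub_zero,
    ← Ideal.Quotient.eq_zero_iff_mem, mk_homogeneousComponent_mul hi' hj',
    Ideal.Quotient.eq_zero_iff_mem] at h1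
  exact (hI.mem_or_mem h1).elim hi hj

theorem hasBoundedDivisors_quotient [Finite σ] [I.IsPrime]
    (hhom : ∀ f ∈ I, ∀ d, homogeneousComponent d f ∈ I) :
    HasBoundedDivisors k (MvPolynomial σ k ⧸ I) := by
  let π : MvPolynomial σ k →ₗ[k] MvPolynomial σ k ⧸ I := (Ideal.Quotient.mkₐ k I).toLinearMap
  let U' : ℕ → Submodule k (MvPolynomial σ k ⧸ I) := fun D => (restrictTotalDegree σ k D).map π
  have hmono : Monotone U' := fun D E hDE => Submodule.map_mono fun f hf => by
    rw [mem_restrictTotalDegree] at hf ⊢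
    exact hf.trans hDE
  intro U hU
  obtain ⟨D, hD⟩ : ∃ D, U ≤ U' D := by
    obtain ⟨s, rfl⟩ := hU
    have : ∀ x : MvPolynomial σ k ⧸ I, ∃ D, x ∈ U' D := fun x => by
      obtain ⟨f, rfl⟩ := Ideal.Quotient.mk_surjective x
      exact ⟨f.totalDegree, f, (mem_restrictTotalDegree _ _ _).mpr le_rfl, rfl⟩
    choose D hD using this
    exact ⟨s.sup D, Submodule.span_le.mpr fun x hx => hmono (Finset.le_sup hx) (hD x)⟩
  refine ⟨U' D, Submodule.FG.map _ (Module.Finite.iff_fg.mp inferInstance), fun g c hg hgc => ?_⟩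
  obtain ⟨f, hf, hfgc⟩ := hD hgc
  obtain ⟨g, rfl⟩ := Ideal.Quotient.mk_surjective g
  obtain ⟨c, rfl⟩ := Ideal.Quotient.mk_surjective c
  have hmem : g * c - f ∈ I := by
    rw [← Ideal.Quotient.eq_zero_iff_mem, map_sub, map_mul, sub_eq_zero]
    exact hfgc.symm
  have hg' : g ∉ I := fun h => hg (Ideal.Quotient.eq_zero_iff_mem.mpr h)
  have hf' : f.totalDegree ≤ D := (mem_restrictTotalDegree _ _ _).mp hf
  refine ⟨∑ i ∈ Finset.range (D + 1), homogeneousComponent i c, ?_, ?_⟩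
  · refine (mem_restrictTotalDegree _ _ _).mpr ?_
    refine totalDegree_finsetSum_le fun i hi => ?_
    exact (homogeneousComponent_isHomogeneous i c).totalDegree_le.trans
      (Nat.lt_succ_iff.mp (Finset.mem_range.mp hi))
  · change Ideal.Quotient.mk I _ = Ideal.Quotient.mk I c
    conv_rhs => rw [← sum_homogeneousComponent c]
    rw [map_sum, map_sum]
    have hzero : ∀ i, D < i → Ideal.Quotient.mk I (homogeneousComponent i c) = 0 := fun i hi =>
      Ideal.Quotient.eq_zero_iff_mem.mpr
        (homogeneousComponent_mem_of_mul_sub_mem hhom hg' hmem (by omega))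
    have hzero' : ∀ i, c.totalDegree < i →
        Ideal.Quotient.mk I (homogeneousComponent i c) = 0 := fun i hi => by
      rw [homogeneousComponent_eq_zero i c hi, map_zero]
    rw [Finset.sum_subset (Finset.range_mono (le_max_left (D + 1) (c.totalDegree + 1))),
      ← Finset.sum_subset (Finset.range_mono (le_max_right (D + 1) (c.totalDegree + 1)))]
    · exact fun i _ hi => hzero' i (by simpa using hi)
    · exact fun i _ hi => hzero i (by simpa using hi)

end CoordRing

end ProjVar

end

noncomputable section

namespace ProjVar

open MvPolynomial

section Dehomogenization

variable {k : Type*} [Field k] {σ : Type*} {X : Set (ProjSpace k σ)}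

theorem toFrac_eq_zero_iff {F : MvPolynomial σ k} : toFrac X F = 0 ↔ F ∈ homogeneousIdeal X := by
  rw [toFrac, RingHom.comp_apply, FaithfulSMul.algebraMap_eq_zero_iff,
    Ideal.Quotient.eq_zero_iff_mem]

theorem eval₂_toFrac (F : MvPolynomial σ k) :
    eval₂ ((toFrac X).comp C) (fun j => toFrac X (MvPolynomial.X j)) F = toFrac X F := by
  conv_rhs => rw [← eval₂_eta F, hom_eval₂]

theorem exists_common_denominator {p : ProjSpace k σ} {c : ℕ → FractionRing (CoordRing X)}
    (hc : ∀ j, c j ∈ localRing X p) (s : Finset ℕ) :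
    ∃ (e : ℕ) (G : MvPolynomial σ k), G.IsHomogeneous e ∧ p ∈ basicOpen G ∧
      ∀ j ∈ s, ∃ F : MvPolynomial σ k, F.IsHomogeneous e ∧ c j * toFrac X G = toFrac X F := by
  classical
  induction s using Finset.induction_on with
  | empty => exact ⟨0, 1, isHomogeneous_one _ _, by simp [basicOpen], by simp⟩
  | insert i s hi ih =>
    obtain ⟨e, G, hG, hpG, H⟩ := ih
    obtain ⟨e', F', G', hF', hG', hpG', hc'⟩ := hc i
    refine ⟨e + e', G * G', hG.mul hG', ?_, fun j hj => ?_⟩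
    · simp only [basicOpen, Set.mem_ofPred_eq, map_mul] at hpG hpG' ⊢
      exact mul_ne_zero hpG hpG'
    · rcases Finset.mem_insert.mp hj with rfl | hj
      · exact ⟨G * F', hG.mul hF', by rw [map_mul, map_mul, ← hc']; ring⟩
      · obtain ⟨F, hF, h⟩ := H j hj
        exact ⟨F * G', hF.mul hG', by rw [map_mul, map_mul, ← h]; ring⟩

variable [hprime : (homogeneousIdeal X).IsPrime]

/-- The homomorphism `F ↦ (F / x_i ^ e) T ^ e`, for `F` a form of degree `e`. -/
def dehomogenize (X : Set (ProjSpace k σ)) [(homogeneousIdeal X).IsPrime] (i : σ) :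
    MvPolynomial σ k →+* Polynomial (FractionRing (CoordRing X)) :=
  eval₂Hom (Polynomial.C.comp ((toFrac X).comp C)) fun j =>
    Polynomial.X * Polynomial.C (toFrac X (MvPolynomial.X j) / toFrac X (MvPolynomial.X i))

theorem dehomogenize_of_isHomogeneous {i : σ} (hi : MvPolynomial.X i ∉ homogeneousIdeal X)
    {F : MvPolynomial σ k} {e : ℕ} (hF : F.IsHomogeneous e) :
    dehomogenize X i F =
      Polynomial.X ^ e * Polynomial.C (toFrac X F / toFrac X (MvPolynomial.X i) ^ e) := by
  have hξ : toFrac X (MvPolynomial.X i) ≠ 0 := fun h => hi (toFrac_eq_zero_iff.mp h)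
  have h1 : toFrac X F = toFrac X (MvPolynomial.X i) ^ e * eval₂ ((toFrac X).comp C)
      (fun j => toFrac X (MvPolynomial.X j) / toFrac X (MvPolynomial.X i)) F := by
    rw [← eval₂_mul_of_isHomogeneous _ hF, ← eval₂_toFrac F]
    congr 1
    funext j
    rw [mul_div_cancel₀ _ hξ]
  rw [dehomogenize, coe_eval₂Hom, eval₂_mul_of_isHomogeneous _ hF, h1,
    mul_div_cancel_left₀ _ (pow_ne_zero _ hξ), hom_eval₂]

theorem dehomogenize_eq_zero_iff [IsAlgClosed k] {i : σ}
    (hi : MvPolynomial.X i ∉ homogeneousIdeal X) {F : MvPolynomial σ k} :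
    dehomogenize X i F = 0 ↔ F ∈ homogeneousIdeal X := by
  have hξ : toFrac X (MvPolynomial.X i) ≠ 0 := fun h => hi (toFrac_eq_zero_iff.mp h)
  have hsum : dehomogenize X i F = ∑ d ∈ Finset.range (F.totalDegree + 1), Polynomial.X ^ d *
      Polynomial.C (toFrac X (homogeneousComponent d F) / toFrac X (MvPolynomial.X i) ^ d) := by
    conv_lhs => rw [← sum_homogeneousComponent F, map_sum]
    exact Finset.sum_congr rfl fun d _ =>
      dehomogenize_of_isHomogeneous hi (homogeneousComponent_isHomogeneous d F)
  constructor
  · intro h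
    refine mem_homogeneousIdeal_of_components fun d => ?_
    by_cases hd : F.totalDegree < d
    · rw [homogeneousComponent_eq_zero d F hd]
      exact Ideal.zero_mem _
    · have h1 := congrArg (fun q => Polynomial.coeff q d) (hsum.symm.trans h)
      simp only [Polynomial.finsetSum_coeff, Polynomial.coeff_mul_C, Polynomial.coeff_X_pow,
        Polynomial.coeff_zero] at h1
      rw [Finset.sum_eq_single d (fun b _ hb => by simp [hb.symm])
        (fun hd' => absurd (Finset.mem_range.mpr (by omega)) hd')] at h1
      rw [← toFrac_eq_zero_iff]
      simpa [hξ] using h1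
  · intro h
    rw [hsum]
    refine Finset.sum_eq_zero fun d _ => ?_
    rw [toFrac_eq_zero_iff.mpr (homogeneousComponent_mem_homogeneousIdeal h d)]
    simp

/-- The dehomogenization, with coefficients in the local ring of a point with `x_i ≠ 0`. -/
theorem exists_lift_dehomogenize {p : ProjSpace k σ} {i : σ} (hpi : p.rep i ≠ 0)
    (hi : MvPolynomial.X i ∉ homogeneousIdeal X) :
    ∃ φ : MvPolynomial σ k →+* Polynomial (localRing X p),
      (Polynomial.mapRingHom (localRing X p).subtype).comp φ = dehomogenize X i := by
  have hξ : toFrac X (MvPolynomial.X i) ≠ 0 := fun h => hi (toFrac_eq_zero_iff.mp h)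
  have hκ : ∀ a : k, ((toFrac X).comp C) a ∈ localRing X p := fun a =>
    ⟨0, C a, 1, isHomogeneous_C _ _, isHomogeneous_one _ _, by simp [basicOpen], by simp⟩
  have hy : ∀ j, toFrac X (MvPolynomial.X j) / toFrac X (MvPolynomial.X i) ∈ localRing X p :=
    fun j => ⟨1, MvPolynomial.X j, MvPolynomial.X i, isHomogeneous_X _ _, isHomogeneous_X _ _,
      by simpa [basicOpen] using hpi, by rw [div_mul_cancel₀ _ hξ]⟩
  refine ⟨eval₂Hom (Polynomial.C.comp (((toFrac X).comp C).codRestrict (localRing X p) hκ))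
    fun j => Polynomial.X * Polynomial.C ⟨_, hy j⟩, ?_⟩
  refine ringHom_ext (fun a => ?_) fun j => ?_
  · simp [dehomogenize]
  · simp [dehomogenize]

theorem exists_form_dvd_mul [IsAlgClosed k] {p : ProjSpace k σ} (hp : p ∈ X)
    (hnorm : IsIntegrallyClosed (localRing X p)) {a b : CoordRing X} (hb : b ≠ 0)
    (hab : IsIntegralFraction a b) :
    ∃ (e : ℕ) (G : MvPolynomial σ k), G.IsHomogeneous e ∧ p ∈ basicOpen G ∧
      b ∣ Ideal.Quotient.mk (homogeneousIdeal X) G * a := by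
  obtain ⟨i, hpi⟩ := Function.ne_iff.mp p.rep_nonzero
  have hi : MvPolynomial.X i ∉ homogeneousIdeal X := fun h => hpi (by
    simpa using h _ (rep_mem_affineCone hp))
  have hξ : toFrac X (MvPolynomial.X i) ≠ 0 := fun h => hi (toFrac_eq_zero_iff.mp h)
  obtain ⟨φ, hφ⟩ := exists_lift_dehomogenize hpi hi
  have hφ' : ∀ F, (φ F).map (localRing X p).subtype = dehomogenize X i F :=
    fun F => DFunLike.congr_fun hφ F
  have hinj : Function.Injective (Polynomial.map (localRing X p).subtype) :=
    Polynomial.map_injective _ Subtype.val_injective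
  have hφ0 : ∀ F, φ F = 0 ↔ F ∈ homogeneousIdeal X := fun F => by
    rw [← dehomogenize_eq_zero_iff hi, ← hφ', Polynomial.map_eq_zero_iff Subtype.val_injective]
  let ψ : CoordRing X →+* Polynomial (localRing X p) :=
    Ideal.Quotient.lift (homogeneousIdeal X) φ fun F hF => (hφ0 F).mpr hF
  obtain ⟨a, rfl⟩ := Ideal.Quotient.mk_surjective a
  obtain ⟨b, rfl⟩ := Ideal.Quotient.mk_surjective b
  have hb' : φ b ≠ 0 := fun h => hb (Ideal.Quotient.eq_zero_iff_mem.mpr ((hφ0 b).mp h))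
  obtain ⟨c, hc⟩ : φ b ∣ φ a := (hab.map ψ).dvd hb'
  obtain ⟨e, G, hG, hpG, H⟩ := exists_common_denominator
    (c := fun j => (c.map (localRing X p).subtype).coeff j)
    (fun j => by rw [Polynomial.coeff_map]; exact (c.coeff j).2)
    (Finset.range ((c.map (localRing X p).subtype).natDegree + 1))
  choose! F hF hFc using H
  refine ⟨e, G, hG, hpG, ?_⟩
  let Q : MvPolynomial σ k := ∑ j ∈ Finset.range
    ((c.map (localRing X p).subtype).natDegree + 1), F j * MvPolynomial.X i ^ j
  have hQ : dehomogenize X i Q = dehomogenize X i G * c.map (localRing X p).subtype := by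
    conv_rhs => rw [Polynomial.as_sum_range_C_mul_X_pow (c.map (localRing X p).subtype)]
    rw [Finset.mul_sum, map_sum]
    refine Finset.sum_congr rfl fun j hj => ?_
    rw [dehomogenize_of_isHomogeneous hi hG,
      dehomogenize_of_isHomogeneous hi ((hF j hj).mul (isHomogeneous_X_pow i j))]
    have : toFrac X (F j * MvPolynomial.X i ^ j) / toFrac X (MvPolynomial.X i) ^ (e + j) =
        toFrac X G / toFrac X (MvPolynomial.X i) ^ e *
          (c.map (localRing X p).subtype).coeff j := by
      rw [map_mul, map_pow, ← hFc j hj, pow_add]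
      field_simp
    rw [this, Polynomial.C_mul, pow_add]
    ring
  refine ⟨Ideal.Quotient.mk _ Q, ?_⟩
  rw [← map_mul, ← map_mul, ← sub_eq_zero, ← map_sub, Ideal.Quotient.eq_zero_iff_mem,
    ← dehomogenize_eq_zero_iff hi, map_sub, map_mul, map_mul, hQ, ← hφ' a, hc, Polynomial.map_mul,
    hφ' b]
  ring

end Dehomogenization

/-- The homogeneous coordinate ring of a normal complete intersection of positive dimension is
integrally closed. -/
theorem isIntegrallyClosed_coordRing {k : Type*} [Field k] [IsAlgClosed k] {n : ℕ}
    (V : IrreducibleCloseds (ProjSpace k (Fin n))) (hnorm : IsNormal V)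
    (hci : IsCompleteIntersection V) (hdim : 0 < dim V) :
    IsIntegrallyClosed (CoordRing (V : Set (ProjSpace k (Fin n)))) := by
  set I := homogeneousIdeal (V : Set (ProjSpace k (Fin n))) with hI
  have hprime : I.IsPrime := isPrime_homogeneousIdeal V.isIrreducible'
  obtain ⟨r, f, hr, -, hf⟩ := hci
  have hht : (r : ℕ∞) ≤ I.height := hr ▸ codim_le_height V
  have hrn : r + 2 ≤ n := by
    have := codim_add_two_le V hdim
    rw [hr] at this
    exact_mod_cast this
  obtain ⟨i₀, hi₀⟩ : ∃ i, MvPolynomial.X i ∉ I := by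
    obtain ⟨p, hp⟩ := V.isIrreducible'.nonempty
    obtain ⟨i, hpi⟩ := Function.ne_iff.mp p.rep_nonzero
    exact ⟨i, fun h => hpi (by simpa using h _ (rep_mem_affineCone hp))⟩
  refine isIntegrallyClosed_of_dvd fun a b hb hab => ?_
  let J : Ideal (MvPolynomial (Fin n) k) :=
    (Submodule.colon (Ideal.span {b}) {a}).comap (Ideal.Quotient.mk I)
  have hJ : ∀ G, G ∈ J ↔ b ∣ Ideal.Quotient.mk I G * a := fun G => by
    rw [Ideal.mem_comap, Submodule.mem_colon_singleton, smul_eq_mul, Ideal.mem_span_singleton]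
  have hIJ : I ≤ J := fun G hG => by
    rw [hJ, Ideal.Quotient.eq_zero_iff_mem.mpr hG, zero_mul]
    exact dvd_zero b
  have hzero : zeroLocus k J ⊆ {0} := by
    intro v hv
    by_contra hv0
    have hvV : v ∈ affineCone (V : Set (ProjSpace k (Fin n))) := by
      rw [← zeroLocus_homogeneousIdeal (X := (V : Set (ProjSpace k (Fin n))))
        V.isClosed' V.isIrreducible'.nonempty]
      exact zeroLocus_anti_mono hIJ hv
    obtain ⟨e, G, hG, hpG, hdvd⟩ := exists_form_dvd_mul (hvV hv0) (hnorm _ (hvV hv0)) hb hab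
    exact (mk_mem_basicOpen_iff hG hv0).mp hpG (hv G ((hJ G).mpr hdvd))
  have hrad : idealOfVars (Fin n) k ≤ J.radical := by
    rw [← vanishingIdeal_zeroLocus_eq_radical (K := k), idealOfVars, Ideal.span_le]
    rintro _ ⟨i, rfl⟩ v hv
    rw [hzero hv]
    simp
  obtain ⟨N, hN⟩ := Ideal.exists_pow_le_of_le_radical_of_fg hrad (idealOfVars_fg (Fin n) k)
  obtain ⟨b, rfl⟩ := Ideal.Quotient.mk_surjective b
  obtain ⟨a, rfl⟩ := Ideal.Quotient.mk_surjective a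
  have hbI : b ∉ I := fun h => hb (Ideal.Quotient.eq_zero_iff_mem.mpr h)
  have hdvd : ∀ x y : MvPolynomial (Fin n) k,
      Ideal.Quotient.mk I x ∣ Ideal.Quotient.mk I y ↔ y ∈ I ⊔ Ideal.span {x} := by
    intro x y
    rw [← Ideal.mem_span_singleton, ← Set.image_singleton, ← Ideal.map_span,
      Ideal.mem_quotient_iff_mem_sup, sup_comm]
  have hstep : ∀ N, idealOfVars (Fin n) k ^ (N + 1) ≤ J → idealOfVars (Fin n) k ^ N ≤ J := by
    intro N hN u hu
    rw [hJ, ← map_mul]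
    have hXu : ∀ i, MvPolynomial.X i * (MvPolynomial.X i₀ * (u * a)) ∈
        I ⊔ Ideal.span {MvPolynomial.X i₀ * b} := by
      intro i
      have h1 : MvPolynomial.X i * u ∈ J := hN (by
        rw [pow_succ']
        exact Ideal.mul_mem_mul (Ideal.subset_span ⟨i, rfl⟩) hu)
      rw [hJ] at h1
      rw [← hdvd, map_mul]
      convert mul_dvd_mul_left (Ideal.Quotient.mk I (MvPolynomial.X i₀)) h1 using 1
      simp only [map_mul]
      ring
    have h2 := mem_sup_span_of_forall_X_mul_mem homogeneousIdeal_le_idealOfVars f hf hht hrn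
      (Ideal.mul_mem_right _ _ (Ideal.subset_span ⟨i₀, rfl⟩))
      (fun h => (hprime.mem_or_mem h).elim hi₀ hbI) hXu
    rw [← hI, ← hdvd, map_mul, map_mul] at h2
    exact (mul_dvd_mul_iff_left fun h => hi₀ (Ideal.Quotient.eq_zero_iff_mem.mp h)).mp h2
  have hone : (1 : MvPolynomial (Fin n) k) ∈ J := by
    have : idealOfVars (Fin n) k ^ 0 ≤ J := by
      clear hrad
      induction N with
      | zero => exact hN
      | succ N ih => exact ih (hstep N hN)
    exact this (by simp)
  simpa using (hJ 1).mp hone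

end ProjVar

end

noncomputable section

namespace ProjVar

open MvPolynomial TensorProduct

section Segre

variable {k : Type*} [Field k] {σ τ : Type*} {V : Set (ProjSpace k σ)} {W : Set (ProjSpace k τ)}

theorem mul_mem_affineCone_segreProduct {v : σ → k} {w : τ → k} (hv : v ∈ affineCone V)
    (hw : w ∈ affineCone W) :
    (fun ij : σ × τ => v ij.1 * w ij.2) ∈ affineCone (segreProduct V W) := by
  intro h0
  have hv0 : v ≠ 0 := fun h => h0 (by funext ij; simp [h])
  have hw0 : w ≠ 0 := fun h => h0 (by funext ij; simp [h])
  exact ⟨_, ⟨hv hv0, hw hw0⟩, segre_mk v w hv0 hw0⟩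

theorem exists_eq_mul_of_mem_affineCone_segreProduct {z : σ × τ → k}
    (hz : z ∈ affineCone (segreProduct V W)) :
    ∃ v ∈ affineCone V, ∃ w ∈ affineCone W, z = fun ij => v ij.1 * w ij.2 := by
  by_cases h0 : z = 0
  · exact ⟨0, zero_mem_affineCone, 0, zero_mem_affineCone, by rw [h0]; funext ij; simp⟩
  · obtain ⟨⟨p, q⟩, ⟨hp, hq⟩, hpq⟩ := hz h0
    rw [segre, eq_comm, Projectivization.mk_eq_mk_iff'] at hpq
    obtain ⟨a, ha⟩ := hpq
    refine ⟨a • p.rep, smul_mem_affineCone (rep_mem_affineCone hp) a, q.rep,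
      rep_mem_affineCone hq, ?_⟩
    rw [← ha]
    funext ij
    simp [mul_assoc]

theorem mem_homogeneousIdeal_segreProduct {F : MvPolynomial (σ × τ) k} :
    F ∈ homogeneousIdeal (segreProduct V W) ↔
      ∀ v ∈ affineCone V, ∀ w ∈ affineCone W, eval (fun ij => v ij.1 * w ij.2) F = 0 := by
  rw [mem_homogeneousIdeal_iff]
  refine ⟨fun h v hv w hw => h _ (mul_mem_affineCone_segreProduct hv hw), fun h z hz => ?_⟩
  obtain ⟨v, hv, w, hw, rfl⟩ := exists_eq_mul_of_mem_affineCone_segreProduct hz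
  exact h v hv w hw

theorem zeroLocus_homogeneousIdeal_segreProduct (hV : IsClosed V) (hV' : V.Nonempty)
    (hW : IsClosed W) (hW' : W.Nonempty) :
    zeroLocus k (homogeneousIdeal (segreProduct V W)) ⊆ affineCone (segreProduct V W) := by
  intro z hz
  by_cases h0 : z = 0
  · rw [h0]
    exact zero_mem_affineCone
  obtain ⟨⟨i₀, j₀⟩, hij⟩ := Function.ne_iff.mp h0
  have hv : (fun i => z (i, j₀)) ∈ affineCone V := by
    rw [← zeroLocus_homogeneousIdeal hV hV']
    intro f hf
    have hmem : rename (fun i => (i, j₀)) f ∈ homogeneousIdeal (segreProduct V W) := by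
      rw [mem_homogeneousIdeal_segreProduct]
      intro v hv w _
      rw [eval_rename]
      have := hf _ (smul_mem_affineCone hv (w j₀))
      convert this using 1
      simp only [aeval_eq_eval]
      congr 1
      congr 1
      funext i
      simp [mul_comm]
    have := hz _ hmem
    rwa [aeval_rename] at this
  have hw : (fun j => z (i₀, j)) ∈ affineCone W := by
    rw [← zeroLocus_homogeneousIdeal hW hW']
    intro f hf
    have hmem : rename (fun j => (i₀, j)) f ∈ homogeneousIdeal (segreProduct V W) := by
      rw [mem_homogeneousIdeal_segreProduct]
      intro v _ w hw
      rw [eval_rename]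
      exact hf _ (smul_mem_affineCone hw (v i₀))
    have := hz _ hmem
    rwa [aeval_rename] at this
  have hminor : ∀ i j, z (i, j) * z (i₀, j₀) = z (i, j₀) * z (i₀, j) := by
    intro i j
    have hmem : (X (i, j) * X (i₀, j₀) - X (i, j₀) * X (i₀, j) : MvPolynomial (σ × τ) k) ∈
        homogeneousIdeal (segreProduct V W) := by
      rw [mem_homogeneousIdeal_segreProduct]
      intro v _ w _
      simp only [map_sub, map_mul, eval_X]
      ring
    have := hz _ hmem
    simpa [sub_eq_zero] using this
  convert mul_mem_affineCone_segreProduct (smul_mem_affineCone hv (z (i₀, j₀))⁻¹) hw using 1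
  funext ij
  have := hminor ij.1 ij.2
  simp only [Pi.smul_apply, smul_eq_mul]
  rw [mul_assoc, ← this, mul_comm (z (ij.1, ij.2)), inv_mul_cancel_left₀ hij]

theorem exists_eq_evalCone (hV : IsClosed V) (hV' : V.Nonempty) (φ : CoordRing V →ₐ[k] k) :
    ∃ (v : σ → k) (hv : v ∈ affineCone V), φ = evalCone hv := by
  let v : σ → k := fun i => φ (Ideal.Quotient.mk _ (X i))
  have hφ : ∀ f, φ (Ideal.Quotient.mk _ f) = eval v f := fun f => by
    have : φ.comp (Ideal.Quotient.mkₐ k (homogeneousIdeal V)) = aeval v :=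
      algHom_ext fun i => by simp [v]
    exact DFunLike.congr_fun this f
  have hv : v ∈ affineCone V := by
    rw [← zeroLocus_homogeneousIdeal hV hV']
    intro f hf
    have := hφ f
    rw [Ideal.Quotient.eq_zero_iff_mem.mpr hf, map_zero] at this
    exact this.symm
  refine ⟨v, hv, AlgHom.ext fun a => ?_⟩
  obtain ⟨f, rfl⟩ := Ideal.Quotient.mk_surjective a
  rw [hφ, evalCone_mk]

/-- The presentation of `S(V) ⊗ S(W)` as a quotient of the polynomial ring in the coordinates of
both factors. -/
def toTensor (V : Set (ProjSpace k σ)) (W : Set (ProjSpace k τ)) :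
    MvPolynomial (σ ⊕ τ) k →ₐ[k] CoordRing V ⊗[k] CoordRing W :=
  aeval (S₁ := CoordRing V ⊗[k] CoordRing W)
    (Sum.elim (fun i => Ideal.Quotient.mk (homogeneousIdeal V) (X i) ⊗ₜ[k] 1)
      fun j => 1 ⊗ₜ[k] Ideal.Quotient.mk (homogeneousIdeal W) (X j))

theorem toTensor_surjective : Function.Surjective (toTensor V W) := by
  have h1 : ∀ f, toTensor V W (rename Sum.inl f) =
      Ideal.Quotient.mk (homogeneousIdeal V) f ⊗ₜ 1 := by
    intro f
    have : (toTensor V W).comp (rename Sum.inl) = (Algebra.TensorProduct.includeLeft (S := k)).comp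
        (Ideal.Quotient.mkₐ k (homogeneousIdeal V)) := algHom_ext fun i => by simp [toTensor]
    exact DFunLike.congr_fun this f
  have h2 : ∀ f, toTensor V W (rename Sum.inr f) =
      1 ⊗ₜ Ideal.Quotient.mk (homogeneousIdeal W) f := by
    intro f
    have : (toTensor V W).comp (rename Sum.inr) = (Algebra.TensorProduct.includeRight).comp
        (Ideal.Quotient.mkₐ k (homogeneousIdeal W)) := algHom_ext fun i => by simp [toTensor]
    exact DFunLike.congr_fun this f
  intro u
  induction u with
  | zero => exact ⟨0, map_zero _⟩
  | tmul a b =>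
    obtain ⟨f, rfl⟩ := Ideal.Quotient.mk_surjective a
    obtain ⟨g, rfl⟩ := Ideal.Quotient.mk_surjective b
    exact ⟨rename Sum.inl f * rename Sum.inr g, by rw [map_mul, h1, h2]; simp⟩
  | add x y hx hy =>
    obtain ⟨f, rfl⟩ := hx
    obtain ⟨g, rfl⟩ := hy
    exact ⟨f + g, map_add _ _ _⟩

theorem evalCone_evalLeft_toTensor {v : σ → k} {w : τ → k} (hv : v ∈ affineCone V)
    (hw : w ∈ affineCone W) (f : MvPolynomial (σ ⊕ τ) k) :
    evalCone hw (evalLeft (CoordRing W) (evalCone hv) (toTensor V W f)) =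
      eval (Sum.elim v w) f := by
  have : ((evalCone hw).comp (evalLeft (CoordRing W) (evalCone hv))).comp (toTensor V W) =
      aeval (Sum.elim v w) := algHom_ext fun i => by
    rcases i with i | j <;> simp [toTensor]
  exact DFunLike.congr_fun this f

theorem toTensor_eq_zero_iff (hV : IsClosed V) (hV' : V.Nonempty) (hW : IsClosed W)
    (hW' : W.Nonempty) {f : MvPolynomial (σ ⊕ τ) k} :
    toTensor V W f = 0 ↔
      ∀ v ∈ affineCone V, ∀ w ∈ affineCone W, eval (Sum.elim v w) f = 0 := by
  constructor
  · intro h v hv w hw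
    rw [← evalCone_evalLeft_toTensor hv hw, h, map_zero, map_zero]
  · intro h
    refine eq_zero_of_evalLeft_eq_zero (hasEnoughPoints_coordRing V) _ fun φ => ?_
    refine hasEnoughPoints_coordRing W _ fun ψ => ?_
    obtain ⟨v, hv, rfl⟩ := exists_eq_evalCone hV hV' φ
    obtain ⟨w, hw, rfl⟩ := exists_eq_evalCone hW hW' ψ
    rw [evalCone_evalLeft_toTensor hv hw, h v hv w hw]

/-- The homomorphism `z_{ij} ↦ x_i y_j`. -/
def segrePullback (k σ τ : Type*) [Field k] :
    MvPolynomial (σ × τ) k →ₐ[k] MvPolynomial (σ ⊕ τ) k :=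
  aeval fun ij => X (Sum.inl ij.1) * X (Sum.inr ij.2)

theorem eval_segrePullback (F : MvPolynomial (σ × τ) k) (v : σ → k) (w : τ → k) :
    eval (Sum.elim v w) (segrePullback k σ τ F) = eval (fun ij => v ij.1 * w ij.2) F := by
  have : (aeval (R := k) (Sum.elim v w)).comp (segrePullback k σ τ) =
      aeval (fun ij => v ij.1 * w ij.2) := algHom_ext fun i => by simp [segrePullback]
  exact DFunLike.congr_fun this F

/-- The weights for which the polynomials of weight `0` are the pullbacks along the Segre
embedding. -/
def segreWeight (σ τ : Type*) : σ ⊕ τ → ℤ := Sum.elim (fun _ => 1) fun _ => -1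

theorem monomial_mem_range_segrePullback (d : σ ⊕ τ →₀ ℕ)
    (hd : Finsupp.weight (segreWeight σ τ) d = 0) (c : k) :
    monomial d c ∈ (segrePullback k σ τ).range := by
  induction hn : d.degree using Nat.strong_induction_on generalizing d with
  | _ n ih =>
  have hsum : ∑ a ∈ d.support, d a • segreWeight σ τ a = 0 := by
    rw [← hd, Finsupp.weight_apply, Finsupp.sum]
  by_cases h0 : d = 0
  · subst h0
    exact Subalgebra.algebraMap_mem _ c
  obtain ⟨i, hi⟩ : ∃ i, d (Sum.inl i) ≠ 0 := by
    by_contra! h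
    refine h0 (Finsupp.ext fun a => ?_)
    by_contra ha
    have := (Finset.sum_eq_zero_iff_of_nonpos (fun a _ => by
      rcases a with i | j
      · simp [h i]
      · simp [segreWeight])).mp hsum a (Finsupp.mem_support_iff.mpr ha)
    rcases a with i | j
    · exact ha (h i)
    · exact ha (by simpa [segreWeight] using this)
  obtain ⟨j, hj⟩ : ∃ j, d (Sum.inr j) ≠ 0 := by
    by_contra! h
    refine h0 (Finsupp.ext fun a => ?_)
    by_contra ha
    have := (Finset.sum_eq_zero_iff_of_nonneg (fun a _ => by
      rcases a with i | j
      · simp [segreWeight]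
      · simp [h j])).mp hsum a (Finsupp.mem_support_iff.mpr ha)
    rcases a with i | j
    · exact ha (by simpa [segreWeight] using this)
    · exact ha (h j)
  obtain ⟨d', rfl⟩ : ∃ d', d =
      d' + (Finsupp.single (Sum.inl i) 1 + Finsupp.single (Sum.inr j) 1) := by
    classical
    refine ⟨d - (Finsupp.single (Sum.inl i) 1 + Finsupp.single (Sum.inr j) 1),
      (tsub_add_cancel_of_le fun a => ?_).symm⟩
    rcases a with a | a
    · by_cases ha : i = a
      · subst ha; simp; omega
      · simp [ha]
    · by_cases ha : j = a
      · subst ha; simp; omega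
      · simp [ha]
  have hd' : Finsupp.weight (segreWeight σ τ) d' = 0 := by
    simpa [Finsupp.weight_single, segreWeight] using hd
  have h1 := ih d'.degree (by rw [← hn]; simp) d' hd' rfl
  have h2 : monomial (d' + (Finsupp.single (Sum.inl i) 1 + Finsupp.single (Sum.inr j) 1)) c =
      monomial d' c * segrePullback k σ τ (X (i, j)) := by
    rw [segrePullback, aeval_X, X, X, monomial_mul, monomial_mul]
    simp
  rw [h2]
  exact Subalgebra.mul_mem _ h1 (AlgHom.mem_range_self _ _)

theorem mem_range_segrePullback {f : MvPolynomial (σ ⊕ τ) k}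
    (hf : f.IsWeightedHomogeneous (segreWeight σ τ) 0) : f ∈ (segrePullback k σ τ).range := by
  rw [f.as_sum]
  exact Subalgebra.sum_mem _ fun d hd =>
    monomial_mem_range_segrePullback d (hf (mem_support_iff.mp hd)) _

/-- The embedding of the homogeneous coordinate ring of `V × W` into `S(V) ⊗ S(W)`. -/
theorem exists_injective_coordRing_segreProduct (hV : IsClosed V) (hV' : V.Nonempty)
    (hW : IsClosed W) (hW' : W.Nonempty) :
    ∃ φ : CoordRing (segreProduct V W) →+* CoordRing V ⊗[k] CoordRing W,
      Function.Injective φ ∧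
        ∀ F, φ (Ideal.Quotient.mk _ F) = toTensor V W (segrePullback k σ τ F) := by
  have key : ∀ F, toTensor V W (segrePullback k σ τ F) = 0 ↔
      F ∈ homogeneousIdeal (segreProduct V W) := fun F => by
    rw [toTensor_eq_zero_iff hV hV' hW hW', mem_homogeneousIdeal_segreProduct]
    simp only [eval_segrePullback]
  refine ⟨Ideal.Quotient.lift _ ((toTensor V W).comp (segrePullback k σ τ)).toRingHom
    fun F hF => (key F).mpr hF, ?_, fun F => rfl⟩
  refine (injective_iff_map_eq_zero _).mpr fun a ha => ?_
  obtain ⟨F, rfl⟩ := Ideal.Quotient.mk_surjective a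
  exact Ideal.Quotient.eq_zero_iff_mem.mpr ((key F).mp ha)

theorem dvd_of_dvd_toTensor [IsAlgClosed k] (hV : IsClosed V) (hV' : V.Nonempty)
    (hW : IsClosed W) (hW' : W.Nonempty) {F G : MvPolynomial (σ × τ) k}
    (h : toTensor V W (segrePullback k σ τ G) ∣ toTensor V W (segrePullback k σ τ F)) :
    Ideal.Quotient.mk (homogeneousIdeal (segreProduct V W)) G ∣ Ideal.Quotient.mk _ F := by
  obtain ⟨c, hc⟩ := h
  obtain ⟨f, rfl⟩ := toTensor_surjective c
  rw [← map_mul, ← sub_eq_zero, ← map_sub, toTensor_eq_zero_iff hV hV' hW hW'] at hc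
  obtain ⟨H, hH⟩ := mem_range_segrePullback
    (weightedHomogeneousComponent_isWeightedHomogeneous (w := segreWeight σ τ) 0 f)
  refine ⟨Ideal.Quotient.mk _ H, ?_⟩
  rw [← map_mul, ← sub_eq_zero, ← map_sub, Ideal.Quotient.eq_zero_iff_mem,
    mem_homogeneousIdeal_segreProduct]
  intro v hv w hw
  set a := eval (fun ij : σ × τ => v ij.1 * w ij.2) F
  set b := eval (fun ij : σ × τ => v ij.1 * w ij.2) G
  have horbit : ∀ t : kˣ, eval (fun i => ((t ^ segreWeight σ τ i : kˣ) : k) * Sum.elim v w i)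
      (C a - C b * f) = 0 := by
    intro t
    have h1 := hc _ (smul_mem_affineCone hv (t : k)) _ (smul_mem_affineCone hw ((t⁻¹ : kˣ) : k))
    have h2 : (fun i => ((t ^ segreWeight σ τ i : kˣ) : k) * Sum.elim v w i) =
        Sum.elim ((t : k) • v) (((t⁻¹ : kˣ) : k) • w) := by
      funext i
      rcases i with i | j <;> simp [segreWeight]
    have h3 : (fun ij : σ × τ => ((t : k) • v) ij.1 * (((t⁻¹ : kˣ) : k) • w) ij.2) =
        fun ij => v ij.1 * w ij.2 := by
      funext ij
      simp only [Pi.smul_apply, smul_eq_mul]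
      rw [mul_mul_mul_comm, Units.mul_inv, one_mul]
    rw [map_sub, map_mul, eval_segrePullback, eval_segrePullback, h3] at h1
    rw [h2, map_sub, map_mul, eval_C, eval_C]
    exact h1
  have h4 := eval_weightedHomogeneousComponent_eq_zero horbit 0
  rw [map_sub, weightedHomogeneousComponent_C_mul, map_sub, map_mul, eval_C, ← hH,
    show (segrePullback k σ τ).toRingHom H = segrePullback k σ τ H from rfl, eval_segrePullback,
    (isWeightedHomogeneous_C (segreWeight σ τ) a).weightedHomogeneousComponent_same, eval_C] at h4
  rw [map_sub, map_mul]
  exact h4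

/-- If `S(V)` and `S(W)` are integrally closed domains, so is the homogeneous coordinate ring of
`V × W` in the Segre embedding. -/
theorem isProjectivelyNormal_segreProduct [IsAlgClosed k] [Finite σ] [Finite τ] (hV : IsClosed V)
    (hV' : IsIrreducible V) (hW : IsClosed W) (hW' : IsIrreducible W)
    (hVn : IsIntegrallyClosed (CoordRing V)) (hWn : IsIntegrallyClosed (CoordRing W)) :
    IsProjectivelyNormal (segreProduct V W) := by
  have := isPrime_homogeneousIdeal hV'
  have := isPrime_homogeneousIdeal hW'
  have hA := hasEnoughPoints_coordRing V
  have hB := hasEnoughPoints_coordRing W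
  have := isDomain_tensorProduct hA hB
  have := isIntegrallyClosed_tensorProduct hA hB
    (hasBoundedDivisors_quotient fun f hf d => homogeneousComponent_mem_homogeneousIdeal hf d)
    (hasBoundedDivisors_quotient fun f hf d => homogeneousComponent_mem_homogeneousIdeal hf d)
  obtain ⟨φ, hφ, hφ'⟩ :=
    exists_injective_coordRing_segreProduct hV hV'.nonempty hW hW'.nonempty
  have hdom : IsDomain (CoordRing (segreProduct V W)) := hφ.isDomain φ
  refine ⟨hdom, isIntegrallyClosed_of_dvd fun a b hb hab => ?_⟩
  have hab' := IsIntegralFraction.map (S := CoordRing V ⊗[k] CoordRing W) φ hab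
  have hdvd := hab'.dvd ((map_ne_zero_iff φ hφ).mpr hb)
  obtain ⟨F, rfl⟩ := Ideal.Quotient.mk_surjective a
  obtain ⟨G, rfl⟩ := Ideal.Quotient.mk_surjective b
  rw [hφ', hφ'] at hdvd
  exact dvd_of_dvd_toTensor hV hV'.nonempty hW hW'.nonempty hdvd

end Segre

end ProjVar

end

noncomputable section

namespace ProjVar

open MvPolynomial

section Sections

variable {k : Type*} [Field k] {σ : Type*} {X : Set (ProjSpace k σ)} {d : ℕ}

theorem sections_smul {s : puncturedCone X → k} (hs : s ∈ sections X d) (v w : puncturedCone X)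
    {t : k} (hw : w.1 = t • v.1) : s w = t ^ d * s v := by
  obtain ⟨hv0, hvX⟩ := v.2
  obtain ⟨e, F, G, hF, hG, hp, h⟩ := hs _ hvX
  have hGv : eval v.1 G ≠ 0 := (mk_mem_basicOpen_iff hG hv0).mp hp
  have ht : t ≠ 0 := by
    rintro rfl
    exact w.2.1 (by rw [hw, zero_smul])
  have hGw : eval w.1 G ≠ 0 := by
    rw [hw, eval_smul_of_isHomogeneous hG]
    exact mul_ne_zero (pow_ne_zero _ ht) hGv
  rw [h v hGv, h w hGw, hw, eval_smul_of_isHomogeneous hG, eval_smul_of_isHomogeneous hF, pow_add]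
  field_simp

theorem mem_pow_idealOfVars_of_isHomogeneous {f : MvPolynomial σ k} {e N : ℕ}
    (hf : f.IsHomogeneous e) (h : N ≤ e) : f ∈ idealOfVars σ k ^ N := by
  rw [mem_pow_idealOfVars_iff]
  intro x hx
  rw [Finsupp.degree_apply, ← hf.degree_eq_sum_deg_support hx]
  exact h

variable [IsAlgClosed k]

theorem mem_homogeneousIdeal_of_puncturedCone (hX : X.Nonempty) {f : MvPolynomial σ k}
    (hf : ∀ v ∈ puncturedCone X, eval v f = 0) : f ∈ homogeneousIdeal X := by
  refine mem_homogeneousIdeal_of_components fun d => ?_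
  rw [mem_homogeneousIdeal_iff_forall_eq_zero (homogeneousComponent_isHomogeneous d f) hX]
  refine fun p hp => eval_homogeneousComponent_eq_zero (fun t => hf _ ?_) d
  exact mem_puncturedCone (smul_mem_affineCone (rep_mem_affineCone hp) _)
    (smul_ne_zero t.ne_zero p.rep_nonzero)

/-- If the product of a section of degree `d` with a form of degree `e` is a polynomial function,
then it is given by a form of degree `e + d`. -/
theorem eval_mul_eq_eval_homogeneousComponent {s : puncturedCone X → k} (hs : s ∈ sections X d)
    {e : ℕ} {p f : MvPolynomial σ k} (hp : p.IsHomogeneous e)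
    (h : ∀ v : puncturedCone X, eval v.1 p * s v = eval v.1 f) (v : puncturedCone X) :
    eval v.1 p * s v = eval v.1 (homogeneousComponent (e + d) f) := by
  obtain ⟨i, hi⟩ := Function.ne_iff.mp v.2.1
  have hi' : v.1 i ≠ 0 := hi
  set c := eval v.1 p * s v / v.1 i ^ (e + d) with hc
  have hm : (C c * MvPolynomial.X i ^ (e + d) : MvPolynomial σ k).IsHomogeneous (e + d) := by
    simpa using (isHomogeneous_C σ c).mul (isHomogeneous_X_pow i (e + d))
  have key := eval_homogeneousComponent_eq_zero (k := k) (v := v.1)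
    (f := f - C c * MvPolynomial.X i ^ (e + d)) (fun t => by
      have htv : (t : k) • v.1 ∈ puncturedCone X :=
        mem_puncturedCone (smul_mem_affineCone (puncturedCone_subset v.2) _)
          (smul_ne_zero t.ne_zero v.2.1)
      have h1 := h ⟨_, htv⟩
      rw [sections_smul hs v ⟨_, htv⟩ rfl, eval_smul_of_isHomogeneous hp] at h1
      rw [map_sub, ← h1, eval_smul_of_isHomogeneous hm]
      simp only [map_mul, map_pow, eval_C, eval_X, hc]
      rw [div_mul_cancel₀ _ (pow_ne_zero _ hi')]
      ring) (e + d)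
  rw [map_sub, homogeneousComponent_of_mem hm, if_pos rfl, map_sub, sub_eq_zero] at key
  rw [key]
  simp only [map_mul, map_pow, eval_C, eval_X, hc]
  rw [div_mul_cancel₀ _ (pow_ne_zero _ hi')]

/-- The ideal of the polynomials whose product with `s` is a polynomial function. -/
def denominatorIdeal (s : puncturedCone X → k) : Ideal (MvPolynomial σ k) where
  carrier := {g | ∃ f : MvPolynomial σ k, ∀ v : puncturedCone X, eval v.1 g * s v = eval v.1 f}
  zero_mem' := ⟨0, by simp⟩
  add_mem' := by
    rintro g g' ⟨f, hf⟩ ⟨f', hf'⟩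
    exact ⟨f + f', fun v => by rw [map_add, map_add, add_mul, hf, hf']⟩
  smul_mem' := by
    rintro c g ⟨f, hf⟩
    exact ⟨c * f, fun v => by rw [smul_eq_mul, map_mul, map_mul, mul_assoc, hf]⟩

theorem exists_pow_le_denominatorIdeal [Finite σ]
    (hzero : zeroLocus k (homogeneousIdeal X) ⊆ affineCone X) {s : puncturedCone X → k}
    (hs : s ∈ sections X d) : ∃ N, idealOfVars σ k ^ N ≤ denominatorIdeal s := by
  have hI : homogeneousIdeal X ≤ denominatorIdeal s := fun g hg => ⟨0, fun v => by
    rw [mem_homogeneousIdeal_iff.mp hg _ (puncturedCone_subset v.2), map_zero, zero_mul]⟩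
  have hloc : zeroLocus k (denominatorIdeal s) ⊆ {0} := by
    intro v hv
    by_contra hv0
    have hvX : v ∈ affineCone X := hzero (zeroLocus_anti_mono hI hv)
    obtain ⟨e, F, G, hF, hG, hp, h⟩ := hs _ (hvX hv0)
    have hGv : eval v G ≠ 0 := (mk_mem_basicOpen_iff hG hv0).mp hp
    have hmem : G * G ∈ denominatorIdeal s := by
      refine ⟨G * F, fun u => ?_⟩
      by_cases hu : eval u.1 G = 0
      · simp [hu]
      · rw [h u hu, map_mul, map_mul]
        field_simp
    have h0 := hv _ hmem
    rw [aeval_eq_eval, map_mul] at h0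
    exact mul_ne_zero hGv hGv h0
  have hrad : idealOfVars σ k ≤ (denominatorIdeal s).radical := by
    rw [← vanishingIdeal_zeroLocus_eq_radical (K := k), idealOfVars, Ideal.span_le]
    rintro _ ⟨i, rfl⟩ v hv
    rw [hloc hv]
    simp
  exact Ideal.exists_pow_le_of_le_radical_of_fg hrad (idealOfVars_fg σ k)

/-- If the homogeneous coordinate ring is an integrally closed domain, all sections of the twisting
sheaves are given by forms. -/
theorem exists_form_of_mem_sections [Finite σ] (hX : X.Nonempty)
    (hzero : zeroLocus k (homogeneousIdeal X) ⊆ affineCone X) (hnorm : IsProjectivelyNormal X)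
    {s : puncturedCone X → k} (hs : s ∈ sections X d) :
    ∃ h : MvPolynomial σ k, h.IsHomogeneous d ∧ ∀ v : puncturedCone X, s v = eval v.1 h := by
  obtain ⟨hdom, hclosed⟩ := hnorm
  obtain ⟨N, hN⟩ := exists_pow_le_denominatorIdeal hzero hs
  let π := Ideal.Quotient.mk (homogeneousIdeal X)
  have hπ : ∀ {f g : MvPolynomial σ k},
      (∀ v : puncturedCone X, eval v.1 f = eval v.1 g) → π f = π g := by
    intro f g h
    rw [← sub_eq_zero, ← map_sub]
    refine Ideal.Quotient.eq_zero_iff_mem.mpr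
      (mem_homogeneousIdeal_of_puncturedCone hX fun v hv => ?_)
    rw [map_sub, h ⟨v, hv⟩, sub_self]
  have hstable : ∀ p ∈ idealOfVars σ k ^ N, ∃ f ∈ idealOfVars σ k ^ N,
      ∀ v : puncturedCone X, eval v.1 p * s v = eval v.1 f := by
    intro p hp
    rw [pow_idealOfVars_eq_span] at hp
    induction hp using Submodule.span_induction with
    | mem p hp =>
      obtain ⟨x, hx, rfl⟩ := hp
      have hm : (monomial x (1 : k)).IsHomogeneous N := isHomogeneous_monomial _ hx
      obtain ⟨f, hf⟩ := hN (mem_pow_idealOfVars_of_isHomogeneous hm le_rfl)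
      exact ⟨_, mem_pow_idealOfVars_of_isHomogeneous (homogeneousComponent_isHomogeneous (N + d) f)
        (Nat.le_add_right N d), eval_mul_eq_eval_homogeneousComponent hs hm hf⟩
    | zero => exact ⟨0, Ideal.zero_mem _, by simp⟩
    | add p q _ _ hp hq =>
      obtain ⟨f, hf, hf'⟩ := hp
      obtain ⟨g, hg, hg'⟩ := hq
      exact ⟨f + g, Ideal.add_mem _ hf hg, fun v => by rw [map_add, map_add, add_mul, hf', hg']⟩
    | smul c p _ hp =>
      obtain ⟨f, hf, hf'⟩ := hp
      exact ⟨c * f, Ideal.mul_mem_left _ _ hf, fun v => by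
        rw [smul_eq_mul, map_mul, map_mul, mul_assoc, hf']⟩
  obtain ⟨p₀, hp₀⟩ := hX
  obtain ⟨i, hi⟩ := Function.ne_iff.mp p₀.rep_nonzero
  have hX : X.Nonempty := ⟨p₀, hp₀⟩
  set x : MvPolynomial σ k := MvPolynomial.X i ^ N with hx
  have hxN : ∀ j, (MvPolynomial.X j ^ N : MvPolynomial σ k) ∈ idealOfVars σ k ^ N := fun j =>
    Ideal.pow_mem_pow (Ideal.subset_span (Set.mem_range_self j)) N
  have hπx : π x ≠ 0 := fun h => by
    have := mem_homogeneousIdeal_iff.mp (Ideal.Quotient.eq_zero_iff_mem.mp h) _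
      (rep_mem_affineCone hp₀)
    simp only [hx, map_pow, eval_X] at this
    exact pow_ne_zero _ hi this
  obtain ⟨f₁, -, hf₁⟩ := hstable x (hxN i)
  have hcross : ∀ p f : MvPolynomial σ k, (∀ v : puncturedCone X, eval v.1 p * s v = eval v.1 f) →
      π f₁ * π p = π x * π f := by
    intro p f hf
    rw [← map_mul, ← map_mul]
    refine hπ fun v => ?_
    rw [map_mul, map_mul, ← hf₁, ← hf]
    ring
  let K := FractionRing (CoordRing X)
  let ι := algebraMap (CoordRing X) K
  have hιx : ι (π x) ≠ 0 := by simpa [ι] using hπx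
  have hint : IsIntegral (CoordRing X) (ι (π f₁) / ι (π x)) := by
    let M : Submodule (CoordRing X) K :=
      Submodule.map (Algebra.linearMap (CoordRing X) K) ((idealOfVars σ k ^ N).map π)
    refine isIntegral_of_smul_mem_submodule M ?_ ?_ _ ?_
    · intro hM
      have : ι (π x) ∈ M := ⟨π x, Ideal.mem_map_of_mem π (hxN i), rfl⟩
      rw [hM] at this
      exact hιx ((Submodule.mem_bot _).mp this)
    · exact Submodule.FG.map _ (IsNoetherian.noetherian _)
    · rintro _ ⟨y, hy, rfl⟩
      obtain ⟨p, hp, rfl⟩ := (Ideal.mem_map_iff_of_surjective π Ideal.Quotient.mk_surjective).mp hy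
      obtain ⟨f, hf, hf'⟩ := hstable p hp
      refine ⟨π f, Ideal.mem_map_of_mem π hf, ?_⟩
      have := congrArg ι (hcross p f hf')
      rw [map_mul, map_mul] at this
      change ι (π f) = ι (π f₁) / ι (π x) * ι (π p)
      rw [div_mul_eq_mul_div, this, mul_div_cancel_left₀ _ hιx]
  obtain ⟨h, hh⟩ := (isIntegrallyClosed_iff K).mp hclosed hint
  obtain ⟨h, rfl⟩ := Ideal.Quotient.mk_surjective h
  have hf₁h : π f₁ = π x * π h := IsFractionRing.injective (CoordRing X) K (by
    rw [map_mul]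
    change ι (π f₁) = ι (π x) * algebraMap (CoordRing X) K (Ideal.Quotient.mk _ h)
    rw [hh, mul_div_cancel₀ _ hιx])
  have hsh : ∀ v : puncturedCone X, s v = eval v.1 h := by
    intro v
    obtain ⟨j, hj⟩ := Function.ne_iff.mp v.2.1
    obtain ⟨f, -, hf⟩ := hstable _ (hxN j)
    have h1 := hcross _ f hf
    rw [hf₁h, mul_assoc] at h1
    have h2 := mul_left_cancel₀ hπx h1
    rw [← map_mul] at h2
    have h3 := congrArg (evalCone (puncturedCone_subset v.2)) h2
    rw [evalCone_mk, evalCone_mk, ← hf, map_mul, mul_comm] at h3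
    refine (mul_left_cancel₀ ?_ h3).symm
    rw [map_pow, eval_X]
    exact pow_ne_zero _ hj
  refine ⟨homogeneousComponent d h, homogeneousComponent_isHomogeneous d h, fun v => ?_⟩
  have := eval_mul_eq_eval_homogeneousComponent hs (f := h) (isHomogeneous_one σ k)
    (fun v => by rw [map_one, one_mul]; exact hsh v) v
  rwa [map_one, one_mul, zero_add] at this

theorem restrictSections_surjective [Finite σ] {Y : Set (ProjSpace k σ)} (hXY : X ⊆ Y)
    (hX : X.Nonempty) (hzero : zeroLocus k (homogeneousIdeal X) ⊆ affineCone X)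
    (hnorm : IsProjectivelyNormal X) (d : ℕ) : Function.Surjective (restrictSections hXY d) := by
  intro s
  obtain ⟨h, hh, hsh⟩ := exists_form_of_mem_sections hX hzero hnorm s.2
  have hmem : (fun v : puncturedCone Y => eval v.1 h) ∈ sections Y d := fun p _ =>
    ⟨0, h, 1, by rwa [zero_add], isHomogeneous_one _ _, by simp [basicOpen], by simp⟩
  refine ⟨⟨_, hmem⟩, Subtype.ext (funext fun v => ?_)⟩
  rw [hsh v]
  rfl

end Sections

end ProjVar

end

theorem segre_product_projectively_normal {k : Type*} [Field k] [IsAlgClosed k] (n m : ℕ)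
    (V : TopologicalSpace.IrreducibleCloseds (ProjVar.ProjSpace k (Fin (n + 1))))
    (W : TopologicalSpace.IrreducibleCloseds (ProjVar.ProjSpace k (Fin (m + 1))))
    (hVn : ProjVar.IsNormal V) (hWn : ProjVar.IsNormal W)
    (hVc : ProjVar.IsCompleteIntersection V) (hWc : ProjVar.IsCompleteIntersection W)
    (hV : 0 < ProjVar.dim V) (hW : 0 < ProjVar.dim W)
    (hdim : 2 < ProjVar.dim V + ProjVar.dim W ∨
      (ProjVar.dim V = 1 ∧ ProjVar.dim W = 1 ∧ n = 2 ∧ m = 2)) :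
    ProjVar.IsProjectivelyNormal
        (ProjVar.segreProduct (V : Set (ProjVar.ProjSpace k (Fin (n + 1))))
          (W : Set (ProjVar.ProjSpace k (Fin (m + 1))))) ∧
      ∀ d : ℕ, Function.Surjective
        (ProjVar.restrictSections
          (ProjVar.segreProduct_subset (V : Set (ProjVar.ProjSpace k (Fin (n + 1))))
            (W : Set (ProjVar.ProjSpace k (Fin (m + 1))))) d) := by
  have hnorm := ProjVar.isProjectivelyNormal_segreProduct
    (V := (V : Set (ProjVar.ProjSpace k (Fin (n + 1)))))
    (W := (W : Set (ProjVar.ProjSpace k (Fin (m + 1)))))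
    V.isClosed' V.isIrreducible' W.isClosed' W.isIrreducible'
    (ProjVar.isIntegrallyClosed_coordRing V hVn hVc hV)
    (ProjVar.isIntegrallyClosed_coordRing W hWn hWc hW)
  refine ⟨hnorm, fun d => ProjVar.restrictSections_surjective _ ?_ ?_ hnorm d⟩
  · exact (V.isIrreducible'.nonempty.prod W.isIrreducible'.nonempty).image _
  · exact ProjVar.zeroLocus_homogeneousIdeal_segreProduct V.isClosed' V.isIrreducible'.nonempty
      W.isClosed' W.isIrreducible'.nonempty
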